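/- arXiv:1603.02961 — 2 statements merged into one kernel-verified Lean document; each statement's English description precedes it below -/
import Mathlib

section
/- There exists ε > 0 with the following property. Let N ≥ 1 be an integer, let γ ∈ (1, 1+ε), and let U : ℝ → ℝ be an even, smooth, nonconstant, 2π-periodic solution of ((γ − (1/2)·U(z)²)·U'(z))' + U(z) = 0 with sup_{z∈ℝ} |U(z)| ≤ ε. For λ ∈ ℝ, let E_λ be the real vector space of smooth 2πN-periodic functions v : ℝ → ℝ with ∫₀^{2πN} v = 0 satisfying (((1/2)·U(z)² − γ − λ)·v(z))'' = v(z) for all z ∈ ℝ. Then: (i) the set of λ > 0 with E_λ ≠ {0} is finite, and the sum of dim E_λ over these λ equals 2N − 1; (ii) E₀ is one-dimensional and is spanned by U'. -/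
open Real

/-- The eigenspace `E_λ`: smooth `2πN`-periodic zero-mean solutions `v` of
`(((1/2)U² − γ − λ)·v)'' = v`, the twice-differentiated form of `L_γ v = λ v`. -/
def EigSetL (U : ℝ → ℝ) (γ lam : ℝ) (N : ℕ) : Set (ℝ → ℝ) :=
  {v | ContDiff ℝ (⊤ : ℕ∞) v ∧ Function.Periodic v (2 * π * N) ∧
    (∫ z in (0:ℝ)..(2 * π * N), v z) = 0 ∧
    ∀ z : ℝ,
      iteratedDeriv 2 (fun w => ((1/2) * (U w) ^ 2 - γ - lam) * v w) z = v z}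

section

open Set Filter Topology
open scoped NNReal

/-- A bounded vector field on `ℝ`, continuous in time and uniformly Lipschitz in space, has global
integral curves. -/
theorem exists_global_integralCurve {f : ℝ → ℝ → ℝ} {K L : ℝ≥0}
    (hf : ∀ t, LipschitzWith K (f t)) (hc : ∀ x, Continuous fun t => f t x)
    (hL : ∀ t x, ‖f t x‖ ≤ L) (x₀ : ℝ) :
    ∃ α : ℝ → ℝ, α 0 = x₀ ∧ ∀ t, HasDerivAt α (f t (α t)) t := by
  have hloc : ∀ n : ℕ, ∃ α : ℝ → ℝ, α 0 = x₀ ∧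
      ∀ t ∈ Ioo (-(n + 1 : ℝ)) (n + 1), HasDerivAt α (f t (α t)) t := by
    intro n
    have h0 : (0 : ℝ) ∈ Icc (-(n + 1 : ℝ)) (n + 1) := ⟨by linarith [n.cast_nonneg (α := ℝ)],
      by positivity⟩
    have hpl : IsPicardLindelof f (⟨0, h0⟩ : Icc (-(n + 1 : ℝ)) (n + 1)) x₀
        (L * (n + 1)) 0 L K :=
      { lipschitzOnWith := fun t _ => (hf t).lipschitzOnWith
        continuousOn := fun x _ => (hc x).continuousOn
        norm_le := fun t _ x _ => hL t x
        mul_max_le := by simp }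
    obtain ⟨α, h1, h2⟩ := hpl.exists_eq_forall_mem_Icc_hasDerivWithinAt₀
    exact ⟨α, h1, fun t ht => (h2 t (Ioo_subset_Icc_self ht)).hasDerivAt (Icc_mem_nhds ht.1 ht.2)⟩
  choose α hα0 hα using hloc
  have hagree : ∀ m n : ℕ, m ≤ n → EqOn (α m) (α n) (Ioo (-(m + 1 : ℝ)) (m + 1)) := by
    intro m n hmn
    have hmn' : (m : ℝ) ≤ n := by exact_mod_cast hmn
    refine ODE_solution_unique_of_mem_Ioo (v := f) (s := fun _ => univ) (K := K) (t₀ := 0)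
      (fun t _ => (hf t).lipschitzOnWith)
      ⟨by linarith [m.cast_nonneg (α := ℝ)], by positivity⟩
      (fun t ht => ⟨hα m t ht, mem_univ _⟩)
      (fun t ht => ⟨hα n t ⟨by linarith [ht.1], by linarith [ht.2]⟩, mem_univ _⟩)
      (by rw [hα0, hα0])
  refine ⟨fun t => α ⌈|t|⌉₊ t, hα0 _, fun t => ?_⟩
  have ht : |t| ≤ ⌈|t|⌉₊ := Nat.le_ceil _
  have hnear : (fun s => α ⌈|s|⌉₊ s) =ᶠ[𝓝 t] α (⌈|t|⌉₊ + 1) := by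
    have hopen : {s : ℝ | |s| < ⌈|t|⌉₊ + 1} ∈ 𝓝 t :=
      (isOpen_lt continuous_abs continuous_const).mem_nhds (show |t| < ⌈|t|⌉₊ + 1 by linarith)
    filter_upwards [hopen] with s hs
    have h1 : ⌈|s|⌉₊ ≤ ⌈|t|⌉₊ + 1 := Nat.ceil_le.2 (by push_cast; exact le_of_lt hs)
    have h2 : |s| ≤ ⌈|s|⌉₊ := Nat.le_ceil _
    exact hagree _ _ h1 (abs_lt.1 (by linarith))
  have hd := hα (⌈|t|⌉₊ + 1) t (abs_lt.1 (by push_cast; linarith))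
  have := hnear.eq_of_nhds
  rw [← this] at hd
  exact hd.congr_of_eventuallyEq hnear

/-- `θ` is a Prüfer angle for the equation `w'' + q w = 0`. -/
def IsPruferAngle (q θ : ℝ → ℝ) : Prop :=
  ∀ t, HasDerivAt θ (cos (θ t) ^ 2 + q t * sin (θ t) ^ 2) t

theorem lipschitzWith_prufer (c : ℝ) {C : ℝ≥0} (hc : |c| ≤ C) :
    LipschitzWith (2 * (1 + C)) (fun x : ℝ => cos x ^ 2 + c * sin x ^ 2) := by
  have hd : ∀ x : ℝ, HasDerivAt (fun x : ℝ => cos x ^ 2 + c * sin x ^ 2)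
      (2 * (c - 1) * (sin x * cos x)) x := by
    intro x
    have := ((hasDerivAt_cos x).pow 2).add (((hasDerivAt_sin x).pow 2).const_mul c)
    convert! this using 1
    ring
  refine lipschitzWith_of_nnnorm_deriv_le (fun x => (hd x).differentiableAt) fun x => ?_
  rw [(hd x).deriv, ← NNReal.coe_le_coe, coe_nnnorm, Real.norm_eq_abs]
  push_cast
  have h1 : |sin x * cos x| ≤ 1 := by
    rw [abs_mul]
    exact mul_le_one₀ (abs_sin_le_one x) (abs_nonneg _) (abs_cos_le_one x)
  have h2 : |c - 1| ≤ 1 + C := by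
    calc |c - 1| ≤ |c| + |(1 : ℝ)| := abs_sub _ _
      _ ≤ 1 + C := by rw [abs_one]; linarith
  rw [abs_mul, abs_mul, abs_two]
  nlinarith [abs_nonneg (c - 1), abs_nonneg (sin x * cos x)]

theorem exists_isPruferAngle {q : ℝ → ℝ} (hq : Continuous q) {C : ℝ≥0} (hC : ∀ t, |q t| ≤ C)
    (a : ℝ) : ∃ θ, θ 0 = a ∧ IsPruferAngle q θ := by
  refine exists_global_integralCurve (K := 2 * (1 + C)) (L := 1 + C)
    (f := fun t x => cos x ^ 2 + q t * sin x ^ 2)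
    (fun t => lipschitzWith_prufer (q t) (hC t)) (fun x => by fun_prop) (fun t x => ?_) a
  rw [Real.norm_eq_abs]
  push_cast
  calc |cos x ^ 2 + q t * sin x ^ 2| ≤ |cos x ^ 2| + |q t * sin x ^ 2| := abs_add_le _ _
    _ = cos x ^ 2 + |q t| * sin x ^ 2 := by
      rw [abs_mul, abs_of_nonneg (sq_nonneg (cos x)), abs_of_nonneg (sq_nonneg (sin x))]
    _ ≤ 1 + C := by nlinarith [sin_sq_add_cos_sq x, sq_nonneg (sin x), sq_nonneg (cos x), hC t]

theorem IsPruferAngle.continuous {q θ : ℝ → ℝ} (h : IsPruferAngle q θ) : Continuous θ :=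
  continuous_iff_continuousAt.2 fun t => (h t).continuousAt

/-- The difference of two Prüfer angles solves a scalar linear equation, here written with its
integrating factor `e`. -/
theorem IsPruferAngle.exists_integrating_factor {q₁ q₂ θ₁ θ₂ : ℝ → ℝ} (h₁ : IsPruferAngle q₁ θ₁)
    (h₂ : IsPruferAngle q₂ θ₂) (hq₁ : Continuous q₁) :
    ∃ e : ℝ → ℝ, (∀ t, 0 < e t) ∧
      ∀ t, HasDerivAt (fun t => (θ₁ t - θ₂ t) * e t)
        ((q₁ t - q₂ t) * sin (θ₂ t) ^ 2 * e t) t := by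
  set g : ℝ → ℝ := fun t => (q₁ t - 1) * (sinc (θ₁ t - θ₂ t) * sin (θ₁ t + θ₂ t)) with hg
  have hgc : Continuous g := by
    have := h₁.continuous
    have := h₂.continuous
    have := continuous_sinc
    fun_prop
  have hG : ∀ t, HasDerivAt (fun t => ∫ s in (0 : ℝ)..t, g s) (g t) t := fun t =>
    intervalIntegral.integral_hasDerivAt_right (hgc.intervalIntegrable _ _)
      (hgc.stronglyMeasurableAtFilter _ _) hgc.continuousAt
  refine ⟨fun t => exp (-∫ s in (0 : ℝ)..t, g s), fun t => exp_pos _, fun t => ?_⟩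
  convert! ((h₁ t).sub (h₂ t)).mul (hG t).neg.exp using 1
  have hsinc : ∀ x : ℝ, x * sinc x = sin x := by
    intro x
    by_cases hx : x = 0
    · simp [hx]
    · rw [sinc_of_ne_zero hx]; field_simp
  have key : (θ₁ t - θ₂ t) * g t = (q₁ t - 1) * (sin (θ₁ t) ^ 2 - sin (θ₂ t) ^ 2) := by
    have h3 : sin (θ₁ t) ^ 2 - sin (θ₂ t) ^ 2 = sin (θ₁ t - θ₂ t) * sin (θ₁ t + θ₂ t) := by
      rw [sin_sub, sin_add]
      have := sin_sq_add_cos_sq (θ₁ t)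
      have := sin_sq_add_cos_sq (θ₂ t)
      have e1 : cos (θ₁ t) ^ 2 = 1 - sin (θ₁ t) ^ 2 := by linarith
      have e2 : cos (θ₂ t) ^ 2 = 1 - sin (θ₂ t) ^ 2 := by linarith
      linear_combination sin (θ₂ t) ^ 2 * e1 - sin (θ₁ t) ^ 2 * e2
    rw [h3, ← hsinc, hg]
    ring
  have e1 := cos_sq' (θ₁ t)
  have e2 := cos_sq' (θ₂ t)
  simp only [Pi.neg_apply, Pi.sub_apply]
  rw [e1, e2]
  linear_combination rexp (-∫ s in (0 : ℝ)..t, g s) * key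

theorem IsPruferAngle.lt_of_lt {q θ₁ θ₂ : ℝ → ℝ} (h₁ : IsPruferAngle q θ₁)
    (h₂ : IsPruferAngle q θ₂) (hq : Continuous q) {s : ℝ} (hs : θ₁ s < θ₂ s) (t : ℝ) :
    θ₁ t < θ₂ t := by
  obtain ⟨e, he, hd⟩ := h₂.exists_integrating_factor h₁ hq
  have hconst := is_const_of_deriv_eq_zero (fun t => (hd t).differentiableAt)
    (fun t => by rw [(hd t).deriv]; ring) t s
  have : 0 < (θ₂ t - θ₁ t) * e t := by
    rw [hconst]; exact mul_pos (by linarith) (he s)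
  linarith [(mul_pos_iff_of_pos_right (he t)).1 this]

theorem IsPruferAngle.eq_of_eq {q θ₁ θ₂ : ℝ → ℝ} (h₁ : IsPruferAngle q θ₁)
    (h₂ : IsPruferAngle q θ₂) (hq : Continuous q) {s : ℝ} (hs : θ₁ s = θ₂ s) (t : ℝ) :
    θ₁ t = θ₂ t := by
  rcases lt_trichotomy (θ₁ t) (θ₂ t) with h | h | h
  · exact absurd hs (h₁.lt_of_lt h₂ hq h s).ne
  · exact h
  · exact absurd hs (h₂.lt_of_lt h₁ hq h s).ne.symm

/-- Strict Sturm comparison for Prüfer angles with the same initial value. -/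
theorem IsPruferAngle.lt_of_potential_le {q₁ q₂ θ₁ θ₂ : ℝ → ℝ} (h₁ : IsPruferAngle q₁ θ₁)
    (h₂ : IsPruferAngle q₂ θ₂) (hq₁ : Continuous q₁) (hq₂ : Continuous q₂)
    (hle : ∀ t, q₁ t ≤ q₂ t) (hlt : q₁ 0 < q₂ 0) (h0 : θ₁ 0 = θ₂ 0) {t : ℝ} (ht : 0 < t) :
    θ₁ t < θ₂ t := by
  obtain ⟨e, he, hd⟩ := h₂.exists_integrating_factor h₁ hq₂
  set F : ℝ → ℝ := fun t => (θ₂ t - θ₁ t) * e t with hF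
  have hmono : Monotone F := by
    refine monotone_of_deriv_nonneg (fun t => (hd t).differentiableAt) fun t => ?_
    rw [(hd t).deriv]
    exact mul_nonneg (mul_nonneg (by linarith [hle t]) (sq_nonneg _)) (he t).le
  have hF0 : F 0 = 0 := by simp [hF, h0]
  by_contra hcon
  have hFt : F t ≤ 0 := mul_nonpos_of_nonpos_of_nonneg (by linarith) (he t).le
  have hzero : ∀ s ∈ Icc 0 t, F s = 0 := fun s hs =>
    le_antisymm ((hmono hs.2).trans hFt) (hF0 ▸ hmono hs.1)
  have hpos : ∀ᶠ s in 𝓝 (0 : ℝ), q₁ s < q₂ s :=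
    (isOpen_lt hq₁ hq₂).mem_nhds hlt
  obtain ⟨δ, hδ, hball⟩ := Metric.eventually_nhds_iff.1 hpos
  set r := min δ t with hr
  have hrpos : 0 < r := lt_min hδ ht
  have hsin : ∀ s ∈ Ioo 0 r, sin (θ₁ s) = 0 := by
    intro s hs
    have hev : F =ᶠ[𝓝 s] fun _ => 0 := by
      filter_upwards [Ioo_mem_nhds hs.1 hs.2] with x hx
      exact hzero x ⟨hx.1.le, hx.2.le.trans (min_le_right _ _)⟩
    have hd0 := (hasDerivAt_const s (0 : ℝ)).congr_of_eventuallyEq hev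
    have := (hd s).unique hd0
    have hq : q₁ s < q₂ s := hball (by
      rw [Real.dist_eq, sub_zero, abs_of_pos hs.1]; exact hs.2.trans_le (min_le_left _ _))
    have h1 : q₂ s - q₁ s ≠ 0 := by linarith
    simpa [h1, (he s).ne'] using this
  have hs : r / 2 ∈ Ioo 0 r := ⟨by linarith, by linarith⟩
  have hev : (fun s => sin (θ₁ s)) =ᶠ[𝓝 (r / 2)] fun _ => 0 := by
    filter_upwards [Ioo_mem_nhds hs.1 hs.2] with x hx using hsin x hx
  have hd0 := (hasDerivAt_const (r / 2) (0 : ℝ)).congr_of_eventuallyEq hev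
  have := ((h₁ (r / 2)).sin).unique hd0
  have h1 := sin_sq_add_cos_sq (θ₁ (r / 2))
  rw [hsin _ hs] at this h1
  have h2 : cos (θ₁ (r / 2)) ^ 2 = 1 := by linarith
  rw [h2] at this
  simp only [ne_eq, OfNat.ofNat_ne_zero, not_false_eq_true, zero_pow, mul_zero, add_zero,
    mul_one] at this
  rw [this] at h2
  norm_num at h2

theorem IsPruferAngle.strictMono {q θ : ℝ → ℝ} (h : IsPruferAngle q θ) (hq : ∀ t, 0 < q t) :
    StrictMono θ := by
  refine strictMono_of_deriv_pos fun t => ?_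
  rw [(h t).deriv]
  have := sin_sq_add_cos_sq (θ t)
  have h1 := hq t
  rcases eq_or_ne (sin (θ t)) 0 with hs | hs
  · rw [hs] at this ⊢; nlinarith
  · have : 0 < q t * sin (θ t) ^ 2 := by positivity
    positivity

/-- Continuous dependence of the Prüfer angle on the potential. -/
theorem IsPruferAngle.dist_le {q₁ q₂ θ₁ θ₂ : ℝ → ℝ} (h₁ : IsPruferAngle q₁ θ₁)
    (h₂ : IsPruferAngle q₂ θ₂) {C : ℝ≥0} (hC : ∀ t, |q₁ t| ≤ C) {ε : ℝ}
    (hε : ∀ t, |q₁ t - q₂ t| ≤ ε) (h0 : θ₁ 0 = θ₂ 0) {t : ℝ} (ht : 0 ≤ t) :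
    dist (θ₁ t) (θ₂ t) ≤ gronwallBound 0 (2 * (1 + C) : ℝ≥0) ε t := by
  have := dist_le_of_approx_trajectories_ODE (K := 2 * (1 + C)) (a := 0) (b := t) (δ := 0)
    (εf := 0) (εg := ε) (v := fun t x => cos x ^ 2 + q₁ t * sin x ^ 2)
    (fun t => lipschitzWith_prufer (q₁ t) (hC t)) h₁.continuous.continuousOn
    (fun s _ => (h₁ s).hasDerivWithinAt) (fun s _ => by simp) h₂.continuous.continuousOn
    (fun s _ => (h₂ s).hasDerivWithinAt) (fun s _ => ?_) (by simp [h0]) t ⟨ht, le_rfl⟩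
  · simpa using this
  · rw [Real.dist_eq]
    have : cos (θ₂ s) ^ 2 + q₂ s * sin (θ₂ s) ^ 2 - (cos (θ₂ s) ^ 2 + q₁ s * sin (θ₂ s) ^ 2)
        = -((q₁ s - q₂ s) * sin (θ₂ s) ^ 2) := by ring
    rw [this, abs_neg, abs_mul, abs_of_nonneg (sq_nonneg (sin (θ₂ s)))]
    have h1 := sin_sq_le_one (θ₂ s)
    nlinarith [hε s, abs_nonneg (q₁ s - q₂ s), sq_nonneg (sin (θ₂ s))]

/-- `w` solves `w'' + q w = 0` and `y = w'`. -/
def IsHillSolution (q w y : ℝ → ℝ) : Prop :=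
  ∀ t, HasDerivAt w (y t) t ∧ HasDerivAt y (-(q t * w t)) t

/-- Solutions `w₁`, `w₂` of `w'' + q w = 0` with derivatives `y₁`, `y₂`, normalized at `0` like
sine and cosine. -/
structure IsFundamentalPair (q w₁ y₁ w₂ y₂ : ℝ → ℝ) : Prop where
  sol₁ : IsHillSolution q w₁ y₁
  sol₂ : IsHillSolution q w₂ y₂
  w₁_zero : w₁ 0 = 0
  y₁_zero : y₁ 0 = 1
  w₂_zero : w₂ 0 = 1
  y₂_zero : y₂ 0 = 0

theorem IsPruferAngle.exists_radius {q θ : ℝ → ℝ} (h : IsPruferAngle q θ) (hq : Continuous q) :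
    ∃ r : ℝ → ℝ, (∀ t, 0 < r t) ∧ r 0 = 1 ∧
      IsHillSolution q (fun t => r t * sin (θ t)) (fun t => r t * cos (θ t)) := by
  set g : ℝ → ℝ := fun t => (1 - q t) * (sin (θ t) * cos (θ t)) with hg
  have hgc : Continuous g := by
    have := h.continuous
    fun_prop
  have hr : ∀ t, HasDerivAt (fun t => exp (∫ s in (0 : ℝ)..t, g s))
      (exp (∫ s in (0 : ℝ)..t, g s) * g t) t := fun t =>
    (intervalIntegral.integral_hasDerivAt_right (hgc.intervalIntegrable _ _)
      (hgc.stronglyMeasurableAtFilter _ _) hgc.continuousAt).exp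
  refine ⟨fun t => exp (∫ s in (0 : ℝ)..t, g s), fun t => exp_pos _, by simp, fun t => ⟨?_, ?_⟩⟩
  · convert! (hr t).mul (h t).sin using 1
    have e1 := cos_sq' (θ t)
    simp only [hg]
    rw [e1]
    ring
  · convert! (hr t).mul (h t).cos using 1
    have e1 := cos_sq' (θ t)
    simp only [hg]
    linear_combination (-(rexp (∫ s in (0 : ℝ)..t, g s) * sin (θ t) * q t)) * (-e1)

theorem exists_fundamentalPair {q θ₁ θ₂ : ℝ → ℝ} (hq : Continuous q) (h₁ : IsPruferAngle q θ₁)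
    (h₂ : IsPruferAngle q θ₂) (h₁0 : θ₁ 0 = 0) (h₂0 : θ₂ 0 = π / 2) :
    ∃ w₁ y₁ w₂ y₂, IsFundamentalPair q w₁ y₁ w₂ y₂ ∧ (∀ t, w₁ t = 0 ↔ sin (θ₁ t) = 0) ∧
      ∀ t, y₂ t = 0 ↔ cos (θ₂ t) = 0 := by
  obtain ⟨r₁, hr₁, hr₁0, hs₁⟩ := h₁.exists_radius hq
  obtain ⟨r₂, hr₂, hr₂0, hs₂⟩ := h₂.exists_radius hq
  refine ⟨_, _, _, _, ⟨hs₁, hs₂, ?_, ?_, ?_, ?_⟩, fun t => ?_, fun t => ?_⟩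
  · simp [h₁0]
  · simp [h₁0, hr₁0]
  · simp [h₂0, hr₂0]
  · simp [h₂0]
  · simp [(hr₁ t).ne']
  · simp [(hr₂ t).ne']

namespace IsHillSolution

variable {q w y v x : ℝ → ℝ}

theorem wronskian_eq (h : IsHillSolution q w y) (h' : IsHillSolution q v x) (s t : ℝ) :
    w s * x s - y s * v s = w t * x t - y t * v t := by
  have hd : ∀ t, HasDerivAt (fun t => w t * x t - y t * v t) 0 t := by
    intro t
    convert! (((h t).1.mul (h' t).2).sub ((h t).2.mul (h' t).1)) using 1
    ring
  exact is_const_of_deriv_eq_zero (fun t => (hd t).differentiableAt) (fun t => (hd t).deriv) s t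

theorem linear_comb (h : IsHillSolution q w y) (h' : IsHillSolution q v x) (a b : ℝ) :
    IsHillSolution q (fun t => a * w t + b * v t) (fun t => a * y t + b * x t) := fun t => by
  refine ⟨((h t).1.const_mul a).add ((h' t).1.const_mul b), ?_⟩
  convert! ((h t).2.const_mul a).add ((h' t).2.const_mul b) using 1
  ring

theorem comp_add_const (h : IsHillSolution q w y) {T : ℝ} (hq : Function.Periodic q T) :
    IsHillSolution q (fun t => w (t + T)) (fun t => y (t + T)) := fun t => by
  refine ⟨(h (t + T)).1.comp_add_const t T, ?_⟩
  have := (h (t + T)).2.comp_add_const t T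
  rwa [hq t] at this

theorem comp_neg (h : IsHillSolution q w y) (hq : ∀ t, q (-t) = q t) :
    IsHillSolution q (fun t => w (-t)) (fun t => -y (-t)) := fun t => by
  refine ⟨?_, ?_⟩
  · convert! (h (-t)).1.scomp t (hasDerivAt_neg t) using 1
    simp
  · convert! ((h (-t)).2.scomp t (hasDerivAt_neg t)).neg using 1
    simp [hq]

theorem contDiff (h : IsHillSolution q w y) (hq : ContDiff ℝ (⊤ : ℕ∞) q) :
    ContDiff ℝ (⊤ : ℕ∞) w := by
  have hdw : deriv w = y := funext fun t => (h t).1.deriv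
  have hdy : deriv y = fun t => -(q t * w t) := funext fun t => (h t).2.deriv
  have hn : ∀ n : ℕ, ContDiff ℝ n w ∧ ContDiff ℝ n y := by
    intro n
    induction n with
    | zero =>
      exact ⟨contDiff_zero.2 (continuous_iff_continuousAt.2 fun t => (h t).1.continuousAt),
        contDiff_zero.2 (continuous_iff_continuousAt.2 fun t => (h t).2.continuousAt)⟩
    | succ n ih =>
      push_cast
      refine ⟨contDiff_succ_iff_deriv.2 ⟨fun t => (h t).1.differentiableAt, by simp, ?_⟩,
        contDiff_succ_iff_deriv.2 ⟨fun t => (h t).2.differentiableAt, by simp, ?_⟩⟩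
      · rw [hdw]; exact ih.2
      · rw [hdy]
        exact ((hq.of_le (by exact_mod_cast le_top)).mul ih.1).neg
  exact contDiff_infty.2 fun n => (hn n).1

end IsHillSolution

namespace IsFundamentalPair

variable {q w₁ y₁ w₂ y₂ w y v x : ℝ → ℝ}

theorem eq_linear_comb (F : IsFundamentalPair q w₁ y₁ w₂ y₂) (h : IsHillSolution q w y) (t : ℝ) :
    w t = w 0 * w₂ t + y 0 * w₁ t ∧ y t = w 0 * y₂ t + y 0 * y₁ t := by
  have e1 := h.wronskian_eq F.sol₁ t 0
  have e2 := h.wronskian_eq F.sol₂ t 0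
  have e3 := F.sol₁.wronskian_eq F.sol₂ t 0
  rw [F.w₁_zero, F.y₁_zero] at e1 e3
  rw [F.w₂_zero, F.y₂_zero] at e2 e3
  constructor
  · linear_combination w t * e3 + w₂ t * e1 - w₁ t * e2
  · linear_combination y t * e3 + y₂ t * e1 - y₁ t * e2

theorem eq_of_eq_at (F : IsFundamentalPair q w₁ y₁ w₂ y₂) (h : IsHillSolution q w y)
    (h' : IsHillSolution q v x) {s : ℝ} (hw : w s = v s) (hy : y s = x s) (t : ℝ) :
    w t = v t := by
  have hd := h.linear_comb h' 1 (-1)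
  have e1 := hd.wronskian_eq F.sol₁ s 0
  have e2 := hd.wronskian_eq F.sol₂ s 0
  have e := (F.eq_linear_comb hd t).1
  simp only [hw, hy, F.w₁_zero, F.y₁_zero, F.w₂_zero, F.y₂_zero] at e1 e2 e
  linear_combination e - w₂ t * e1 + w₁ t * e2

theorem y₁_even (F : IsFundamentalPair q w₁ y₁ w₂ y₂) (hq : ∀ t, q (-t) = q t) (t : ℝ) :
    w₁ (-t) = -w₁ t ∧ y₁ (-t) = y₁ t := by
  have := F.eq_linear_comb (F.sol₁.comp_neg hq) t
  simp only [neg_zero, F.w₁_zero, F.y₁_zero] at this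
  constructor <;> linarith [this.1, this.2]

theorem w₂_even (F : IsFundamentalPair q w₁ y₁ w₂ y₂) (hq : ∀ t, q (-t) = q t) (t : ℝ) :
    w₂ (-t) = w₂ t ∧ y₂ (-t) = -y₂ t := by
  have := F.eq_linear_comb (F.sol₂.comp_neg hq) t
  simp only [neg_zero, F.w₂_zero, F.y₂_zero] at this
  constructor <;> linarith [this.1, this.2]

/-- For an even periodic potential, periodicity splits into a Dirichlet condition on the odd part
and a Neumann condition on the even part, both at the half period. -/
theorem periodic_iff (F : IsFundamentalPair q w₁ y₁ w₂ y₂) (hq : ∀ t, q (-t) = q t) {h : ℝ}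
    (hT : Function.Periodic q (2 * h)) (hw : IsHillSolution q w y) :
    Function.Periodic w (2 * h) ↔ w 0 * y₂ h = 0 ∧ y 0 * w₁ h = 0 := by
  have hshift : -h + 2 * h = h := by ring
  have a1 := F.y₁_even hq h
  have a2 := F.w₂_even hq h
  have e1 := F.eq_linear_comb hw h
  have e2 := F.eq_linear_comb hw (-h)
  constructor
  · intro hp
    have hpy : y (-h + 2 * h) = y (-h) := by
      have h1 := (hw (-h + 2 * h)).1.comp_add_const (-h) (2 * h)
      rw [show (fun t => w (t + 2 * h)) = w from funext hp] at h1
      exact h1.unique (hw (-h)).1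
    have hpw := hp (-h)
    rw [hshift] at hpy hpw
    rw [a1.1, a1.2, a2.1, a2.2] at e2
    constructor <;> linarith [e1.1, e1.2, e2.1, e2.2]
  · rintro ⟨h1, h2⟩ t
    refine F.eq_of_eq_at (hw.comp_add_const hT) hw (s := -h) ?_ ?_ t
    · simp only [hshift]
      rw [e1.1, e2.1, a1.1, a2.1]
      linarith
    · simp only [hshift]
      rw [e1.2, e2.2, a1.2, a2.2]
      linarith

end IsFundamentalPair

theorem mem_EigSetL_iff {U q : ℝ → ℝ} {γ lam : ℝ} {N : ℕ} (hU : ContDiff ℝ (⊤ : ℕ∞) U)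
    (hper : Function.Periodic U (2 * π)) (hpos : ∀ z, 0 < γ + lam - (1/2) * (U z) ^ 2)
    (hq : ∀ z, q z = (γ + lam - (1/2) * (U z) ^ 2)⁻¹) (v : ℝ → ℝ) :
    v ∈ EigSetL U γ lam N ↔
      ∃ w y, IsHillSolution q w y ∧ Function.Periodic w (2 * π * N) ∧ v = fun z => -q z * w z := by
  have hperN : Function.Periodic U (2 * π * N) := by
    rw [mul_comm]; exact hper.nat_mul N
  have hPs : ContDiff ℝ (⊤ : ℕ∞) (fun z => (1/2) * (U z) ^ 2 - γ - lam) := by fun_prop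
  have hqs : ContDiff ℝ (⊤ : ℕ∞) q := by
    rw [show q = fun z => (γ + lam - (1/2) * (U z) ^ 2)⁻¹ from funext hq]
    exact ContDiff.inv (by fun_prop) fun z => (hpos z).ne'
  constructor
  · rintro ⟨hv, hvp, -, heq⟩
    set F : ℝ → ℝ := fun z => ((1/2) * (U z) ^ 2 - γ - lam) * v z with hF
    have hFs : ContDiff ℝ (⊤ : ℕ∞) F := hPs.mul hv
    have hFs' : ContDiff ℝ (⊤ : ℕ∞) (deriv F) := (contDiff_infty_iff_deriv.1 hFs).2
    have hv' : v = fun z => -q z * F z := by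
      funext z
      have hinv := mul_inv_cancel₀ (hpos z).ne'
      simp only [hq, hF]
      linear_combination (-(v z)) * hinv
    refine ⟨F, deriv F, fun t => ⟨(hFs.differentiable (by simp) t).hasDerivAt, ?_⟩, ?_, hv'⟩
    · have h1 := (hFs'.differentiable (by simp) t).hasDerivAt
      have h2 := heq t
      rw [iteratedDeriv_succ, iteratedDeriv_one] at h2
      rw [h2] at h1
      convert! h1 using 1
      rw [congrFun hv' t]
      ring
    · intro z
      simp only [hF, hperN z, hvp z]
  · rintro ⟨w, y, hw, hwp, rfl⟩
    have hws := hw.contDiff hqs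
    have hqp : Function.Periodic q (2 * π * N) := fun z => by rw [hq, hq, hperN z]
    have hyp : y (2 * π * N) = y 0 := by
      have h1 := (hw (0 + 2 * π * N)).1.comp_add_const 0 (2 * π * N)
      rw [show (fun t => w (t + 2 * π * N)) = w from funext hwp, zero_add] at h1
      exact h1.unique (hw 0).1
    have hvs : ContDiff ℝ (⊤ : ℕ∞) fun z => -q z * w z := hqs.neg.mul hws
    refine ⟨hvs, fun z => by simp only [hqp z, hwp z], ?_, fun z => ?_⟩
    · rw [intervalIntegral.integral_eq_sub_of_hasDerivAt (f := y)
        (fun t _ => by convert! (hw t).2 using 1; ring)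
        (hvs.continuous.intervalIntegrable _ _), hyp, sub_self]
    · have hFw : (fun z => ((1/2) * (U z) ^ 2 - γ - lam) * (-q z * w z)) = w := by
        funext z
        have hinv := mul_inv_cancel₀ (hpos z).ne'
        rw [hq]
        linear_combination w z * hinv
      rw [hFw, iteratedDeriv_succ, iteratedDeriv_one,
        show deriv w = y from funext fun t => (hw t).1.deriv, (hw z).2.deriv]
      ring

theorem EigSetL_eq {U q w₁ y₁ w₂ y₂ : ℝ → ℝ} {γ lam : ℝ} {N : ℕ} (hU : ContDiff ℝ (⊤ : ℕ∞) U)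
    (heven : ∀ z, U (-z) = U z)
    (hper : Function.Periodic U (2 * π)) (hpos : ∀ z, 0 < γ + lam - (1/2) * (U z) ^ 2)
    (hq : ∀ z, q z = (γ + lam - (1/2) * (U z) ^ 2)⁻¹) (F : IsFundamentalPair q w₁ y₁ w₂ y₂) :
    EigSetL U γ lam N = {v | ∃ a b : ℝ, (¬ y₂ (π * N) = 0 → a = 0) ∧ (¬ w₁ (π * N) = 0 → b = 0) ∧
      v = a • (fun z => -q z * w₂ z) + b • (fun z => -q z * w₁ z)} := by
  have hperN : Function.Periodic U (2 * (π * N)) := by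
    rw [← mul_assoc, mul_comm]; exact hper.nat_mul N
  have hqe : ∀ z, q (-z) = q z := fun z => by rw [hq, hq, heven]
  have hqp : Function.Periodic q (2 * (π * N)) := fun z => by rw [hq, hq, hperN z]
  ext v
  rw [mem_EigSetL_iff hU hper hpos hq]
  simp only [Set.mem_ofPred_eq, mul_assoc]
  constructor
  · rintro ⟨w, y, hw, hwp, rfl⟩
    have := (F.periodic_iff hqe hqp hw).1 hwp
    refine ⟨w 0, y 0, fun h => (mul_eq_zero.1 this.1).resolve_right h,
      fun h => (mul_eq_zero.1 this.2).resolve_right h, ?_⟩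
    funext z
    simp only [Pi.add_apply, Pi.smul_apply, smul_eq_mul]
    rw [(F.eq_linear_comb hw z).1]
    ring
  · rintro ⟨a, b, ha, hb, rfl⟩
    have hw := F.sol₂.linear_comb F.sol₁ a b
    refine ⟨_, _, hw, (F.periodic_iff hqe hqp hw).2 ?_, ?_⟩
    · simp only [F.w₁_zero, F.y₁_zero, F.w₂_zero, F.y₂_zero]
      constructor
      · by_cases h : y₂ (π * N) = 0
        · simp [h]
        · simp [ha h]
      · by_cases h : w₁ (π * N) = 0
        · simp [h]
        · simp [hb h]
    · funext z
      simp only [Pi.add_apply, Pi.smul_apply, smul_eq_mul]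
      ring

theorem IsFundamentalPair.linearIndependent {q w₁ y₁ w₂ y₂ : ℝ → ℝ}
    (F : IsFundamentalPair q w₁ y₁ w₂ y₂) (hq : ∀ z, q z ≠ 0) :
    LinearIndependent ℝ ![fun z => -q z * w₂ z, fun z => -q z * w₁ z] := by
  rw [LinearIndependent.pair_iff]
  intro a b hab
  have hz : ∀ z, a * w₂ z + b * w₁ z = 0 := by
    intro z
    have := congrFun hab z
    simp only [Pi.add_apply, Pi.smul_apply, smul_eq_mul, Pi.zero_apply] at this
    have h : -q z * (a * w₂ z + b * w₁ z) = 0 := by linarith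
    exact (mul_eq_zero.1 h).resolve_left (neg_ne_zero.2 (hq z))
  have ha : a = 0 := by simpa [F.w₁_zero, F.w₂_zero] using hz 0
  refine ⟨ha, ?_⟩
  have hd := ((F.sol₂.linear_comb F.sol₁ a b) 0).1
  rw [show (fun t => a * w₂ t + b * w₁ t) = fun _ => 0 from funext hz] at hd
  have := hd.unique (hasDerivAt_const 0 0)
  simpa [F.y₁_zero, F.y₂_zero] using this

section Span

variable {V : Type*} [AddCommGroup V] [Module ℝ V] {e₁ e₂ : V}

open Classical in
theorem finrank_span_constrained_pair (hli : LinearIndependent ℝ ![e₁, e₂]) (P Q : Prop) :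
    Module.finrank ℝ (Submodule.span ℝ
      {v : V | ∃ a b : ℝ, (¬ P → a = 0) ∧ (¬ Q → b = 0) ∧ v = a • e₁ + b • e₂}) =
      (if P then 1 else 0) + (if Q then 1 else 0) := by
  have he₁ : e₁ ≠ 0 := hli.ne_zero 0
  have he₂ : e₂ ≠ 0 := hli.ne_zero 1
  by_cases hP : P <;> by_cases hQ : Q
  · have : {v : V | ∃ a b : ℝ, (¬ P → a = 0) ∧ (¬ Q → b = 0) ∧ v = a • e₁ + b • e₂} =
        (Submodule.span ℝ (Set.range ![e₁, e₂]) : Set V) := by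
      ext v
      simp only [hP, hQ, Set.mem_ofPred_eq, not_true_eq_false, false_imp_iff, true_and,
        Matrix.range_cons, Matrix.range_empty, Set.union_empty, Set.singleton_union,
        SetLike.mem_coe, Submodule.mem_span_pair, eq_comm (a := v)]
    rw [this, Submodule.span_span, finrank_span_eq_card hli]
    simp [hP, hQ]
  · have : {v : V | ∃ a b : ℝ, (¬ P → a = 0) ∧ (¬ Q → b = 0) ∧ v = a • e₁ + b • e₂} =
        (Submodule.span ℝ {e₁} : Set V) := by
      ext v
      simp [hP, hQ, Submodule.mem_span_singleton, eq_comm]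
    rw [this, Submodule.span_span, finrank_span_singleton he₁]
    simp [hP, hQ]
  · have : {v : V | ∃ a b : ℝ, (¬ P → a = 0) ∧ (¬ Q → b = 0) ∧ v = a • e₁ + b • e₂} =
        (Submodule.span ℝ {e₂} : Set V) := by
      ext v
      simp [hP, hQ, Submodule.mem_span_singleton, eq_comm]
    rw [this, Submodule.span_span, finrank_span_singleton he₂]
    simp [hP, hQ]
  · have : {v : V | ∃ a b : ℝ, (¬ P → a = 0) ∧ (¬ Q → b = 0) ∧ v = a • e₁ + b • e₂} =
        (Submodule.span ℝ (∅ : Set V) : Set V) := by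
      ext v
      simp [hP, hQ]
    rw [this, Submodule.span_span, Submodule.span_empty, finrank_bot]
    simp [hP, hQ]

theorem exists_ne_zero_constrained_pair_iff (hli : LinearIndependent ℝ ![e₁, e₂]) (P Q : Prop) :
    (∃ v ∈ {v : V | ∃ a b : ℝ, (¬ P → a = 0) ∧ (¬ Q → b = 0) ∧ v = a • e₁ + b • e₂}, v ≠ 0) ↔
      P ∨ Q := by
  constructor
  · rintro ⟨v, ⟨a, b, ha, hb, rfl⟩, hv⟩
    by_contra hcon
    rw [not_or] at hcon
    exact hv (by simp [ha hcon.1, hb hcon.2])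
  · rintro (hP | hQ)
    · exact ⟨e₁, ⟨1, 0, fun h => absurd hP h, fun _ => rfl, by simp⟩, hli.ne_zero 0⟩
    · exact ⟨e₂, ⟨0, 1, fun _ => rfl, fun h => absurd hQ h, by simp⟩, hli.ne_zero 1⟩

end Span

/-- A continuous strictly increasing function from `[a, b]` crosses each intermediate lattice
value `c + n π` exactly once. -/
theorem ncard_lattice_crossings {f : ℝ → ℝ} {a b c : ℝ} {M : ℕ} (hab : a ≤ b)
    (hf : ContinuousOn f (Icc a b)) (hm : StrictMonoOn f (Icc a b)) (ha : c ≤ f a)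
    (ha' : f a < c + π) (hb : c + M * π < f b) (hb' : f b ≤ c + (M + 1) * π) :
    {x | x ∈ Ioo a b ∧ ∃ n : ℤ, f x = c + n * π}.Finite ∧
      {x | x ∈ Ioo a b ∧ ∃ n : ℤ, f x = c + n * π}.ncard = M := by
  have hex : ∀ n : ℕ, n ∈ Finset.Icc 1 M → ∃ x, x ∈ Ioo a b ∧ f x = c + n * π := by
    intro n hn
    rw [Finset.mem_Icc] at hn
    have h1 : (1 : ℝ) ≤ n := by exact_mod_cast hn.1
    have h2 : (n : ℝ) ≤ M := by exact_mod_cast hn.2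
    have : c + n * π ∈ Ioo (f a) (f b) :=
      ⟨by nlinarith [pi_pos], by nlinarith [pi_pos]⟩
    obtain ⟨x, hx, hfx⟩ := intermediate_value_Ioo hab hf this
    exact ⟨x, hx, hfx⟩
  choose! g hg using hex
  have himage : {x | x ∈ Ioo a b ∧ ∃ n : ℤ, f x = c + n * π} =
      ((Finset.Icc 1 M).image g : Finset ℝ) := by
    ext x
    simp only [Set.mem_ofPred_eq, Finset.coe_image, Set.mem_image, Finset.mem_coe]
    constructor
    · rintro ⟨hx, n, hn⟩
      have hI := Ioo_subset_Icc_self hx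
      have h1 := hm (left_mem_Icc.2 hab) hI hx.1
      have h2 := hm hI (right_mem_Icc.2 hab) hx.2
      have h3 : (0 : ℝ) < n := by
        by_contra hcon
        nlinarith [pi_pos]
      have h4 : (n : ℝ) < M + 1 := by
        by_contra hcon
        nlinarith [pi_pos]
      have h3' : 0 < n := by exact_mod_cast h3
      have h4' : n < M + 1 := by exact_mod_cast h4
      obtain ⟨k, rfl⟩ := Int.eq_ofNat_of_zero_le h3'.le
      have hk : k ∈ Finset.Icc 1 M := by rw [Finset.mem_Icc]; omega
      refine ⟨k, hk, hm.injOn (Ioo_subset_Icc_self (hg k hk).1) hI ?_⟩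
      rw [(hg k hk).2, hn]
      push_cast
      rfl
    · rintro ⟨k, hk, rfl⟩
      exact ⟨(hg k hk).1, k, by rw [(hg k hk).2]; push_cast; rfl⟩
  rw [himage]
  refine ⟨Finset.finite_toSet _, ?_⟩
  rw [Set.ncard_coe_finset, Finset.card_image_of_injOn, Nat.card_Icc, Nat.add_sub_cancel]
  intro k hk l hl hkl
  have e1 := (hg k hk).2
  rw [hkl, (hg l hl).2] at e1
  have := mul_right_cancel₀ pi_ne_zero (add_left_cancel e1)
  exact_mod_cast this.symm

/-- The Hill potential of the spectral problem in terms of `μ = 1 / (γ + λ)`; it extends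
continuously to `μ = 0`. -/
noncomputable def hillPotential (U : ℝ → ℝ) (μ z : ℝ) : ℝ := μ / (1 - μ * ((1/2) * (U z) ^ 2))

section Potential

variable {U : ℝ → ℝ} {μ ν : ℝ}

theorem hillPotential_denom_ge (hb : ∀ z, |U z| ≤ 1/2) (hμ : μ ∈ Icc (0 : ℝ) 1) (z : ℝ) :
    7/8 ≤ 1 - μ * ((1/2) * (U z) ^ 2) := by
  have h1 : (U z) ^ 2 ≤ 1/4 := by
    have := abs_le.1 (hb z)
    nlinarith [this.1, this.2]
  nlinarith [hμ.1, hμ.2, sq_nonneg (U z)]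

theorem continuous_hillPotential (hU : Continuous U) (hb : ∀ z, |U z| ≤ 1/2)
    (hμ : μ ∈ Icc (0 : ℝ) 1) : Continuous (hillPotential U μ) := by
  unfold hillPotential
  refine Continuous.div (by fun_prop) (by fun_prop) fun z => ?_
  linarith [hillPotential_denom_ge hb hμ z]

theorem hillPotential_nonneg (hb : ∀ z, |U z| ≤ 1/2) (hμ : μ ∈ Icc (0 : ℝ) 1) (z : ℝ) :
    0 ≤ hillPotential U μ z :=
  div_nonneg hμ.1 (by linarith [hillPotential_denom_ge hb hμ z])

theorem hillPotential_lt_two (hb : ∀ z, |U z| ≤ 1/2) (hμ : μ ∈ Icc (0 : ℝ) 1) (z : ℝ) :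
    hillPotential U μ z < 2 := by
  have := hillPotential_denom_ge hb hμ z
  rw [hillPotential, div_lt_iff₀ (by linarith)]
  linarith [hμ.2]

theorem hillPotential_sub (hb : ∀ z, |U z| ≤ 1/2) (hμ : μ ∈ Icc (0 : ℝ) 1)
    (hν : ν ∈ Icc (0 : ℝ) 1) (z : ℝ) :
    hillPotential U μ z - hillPotential U ν z =
      (μ - ν) / ((1 - μ * ((1/2) * (U z) ^ 2)) * (1 - ν * ((1/2) * (U z) ^ 2))) := by
  have h1 : 1 - μ * ((1/2) * (U z) ^ 2) ≠ 0 := by linarith [hillPotential_denom_ge hb hμ z]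
  have h2 : 1 - ν * ((1/2) * (U z) ^ 2) ≠ 0 := by linarith [hillPotential_denom_ge hb hν z]
  rw [hillPotential, hillPotential, div_sub_div _ _ h1 h2]
  congr 1
  ring

theorem hillPotential_lt (hb : ∀ z, |U z| ≤ 1/2) (hμ : μ ∈ Icc (0 : ℝ) 1)
    (hν : ν ∈ Icc (0 : ℝ) 1) (h : μ < ν) (z : ℝ) : hillPotential U μ z < hillPotential U ν z := by
  have h1 := hillPotential_denom_ge hb hμ z
  have h2 := hillPotential_denom_ge hb hν z
  rw [← sub_pos, hillPotential_sub hb hν hμ]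
  exact div_pos (by linarith) (mul_pos (by linarith) (by linarith))

theorem abs_hillPotential_sub_le (hb : ∀ z, |U z| ≤ 1/2) (hμ : μ ∈ Icc (0 : ℝ) 1)
    (hν : ν ∈ Icc (0 : ℝ) 1) (z : ℝ) :
    |hillPotential U μ z - hillPotential U ν z| ≤ 2 * |μ - ν| := by
  have h1 := hillPotential_denom_ge hb hμ z
  have h2 := hillPotential_denom_ge hb hν z
  have h3 : 1/2 ≤ (1 - μ * ((1/2) * (U z) ^ 2)) * (1 - ν * ((1/2) * (U z) ^ 2)) := by nlinarith
  rw [hillPotential_sub hb hμ hν, abs_div, abs_of_pos (by linarith : (0 : ℝ) < _ * _),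
    div_le_iff₀ (by linarith)]
  nlinarith [abs_nonneg (μ - ν)]

theorem hillPotential_eq_inv {γ lam : ℝ} (h : 0 < γ + lam) (z : ℝ) :
    hillPotential U (γ + lam)⁻¹ z = (γ + lam - (1/2) * (U z) ^ 2)⁻¹ := by
  rw [hillPotential, inv_eq_one_div, div_div, mul_sub, one_div]
  congr 1
  field_simp

theorem exists_pruferAngle_hillPotential (hU : Continuous U) (hb : ∀ z, |U z| ≤ 1/2) (a : ℝ) :
    ∃ θ : ℝ → ℝ → ℝ, ∀ μ ∈ Icc (0 : ℝ) 1,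
      θ μ 0 = a ∧ IsPruferAngle (hillPotential U μ) (θ μ) := by
  have : ∀ μ ∈ Icc (0 : ℝ) 1, ∃ θ : ℝ → ℝ, θ 0 = a ∧ IsPruferAngle (hillPotential U μ) θ := by
    intro μ hμ
    refine exists_isPruferAngle (continuous_hillPotential hU hb hμ) (C := 2) (fun t => ?_) a
    rw [abs_of_nonneg (hillPotential_nonneg hb hμ t)]
    exact (hillPotential_lt_two hb hμ t).le
  choose! θ hθ using this
  exact ⟨θ, hθ⟩

theorem strictMonoOn_pruferAngle_hillPotential (hU : Continuous U) (hb : ∀ z, |U z| ≤ 1/2)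
    {θ : ℝ → ℝ → ℝ} {a : ℝ} (hθ : ∀ μ ∈ Icc (0 : ℝ) 1,
      θ μ 0 = a ∧ IsPruferAngle (hillPotential U μ) (θ μ)) {h : ℝ} (hh : 0 < h) :
    StrictMonoOn (fun μ => θ μ h) (Icc 0 1) := fun μ hμ ν hν hlt =>
  (hθ μ hμ).2.lt_of_potential_le (hθ ν hν).2 (continuous_hillPotential hU hb hμ)
    (continuous_hillPotential hU hb hν) (fun t => (hillPotential_lt hb hμ hν hlt t).le)
    (hillPotential_lt hb hμ hν hlt 0) ((hθ μ hμ).1.trans (hθ ν hν).1.symm) hh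

theorem continuousOn_pruferAngle_hillPotential (hb : ∀ z, |U z| ≤ 1/2)
    {θ : ℝ → ℝ → ℝ} {a : ℝ} (hθ : ∀ μ ∈ Icc (0 : ℝ) 1,
      θ μ 0 = a ∧ IsPruferAngle (hillPotential U μ) (θ μ)) {h : ℝ} (hh : 0 ≤ h) :
    ContinuousOn (fun μ => θ μ h) (Icc 0 1) := by
  intro ν hν
  rw [ContinuousWithinAt, tendsto_iff_dist_tendsto_zero]
  have hlim : Tendsto (fun μ => gronwallBound 0 (2 * (1 + 2) : ℝ≥0) (2 * |μ - ν|) h)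
      (𝓝[Icc 0 1] ν) (𝓝 0) := by
    have hc : Continuous fun μ => gronwallBound 0 (2 * (1 + 2) : ℝ≥0) (2 * |μ - ν|) h :=
      (gronwallBound_continuous_ε 0 (2 * (1 + 2) : ℝ≥0) h).comp
        (by fun_prop : Continuous fun μ : ℝ => 2 * |μ - ν|)
    have := (hc.tendsto ν).mono_left (nhdsWithin_le_nhds (s := Icc 0 1))
    simpa only [sub_self, abs_zero, mul_zero, gronwallBound_ε0_δ0] using this
  refine squeeze_zero' (Eventually.of_forall fun _ => dist_nonneg) ?_ hlim
  filter_upwards [self_mem_nhdsWithin] with μ hμ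
  refine (hθ μ hμ).2.dist_le (hθ ν hν).2 (C := 2) (fun t => ?_)
    (fun t => abs_hillPotential_sub_le hb hμ hν t) ((hθ μ hμ).1.trans (hθ ν hν).1.symm) hh
  rw [abs_of_nonneg (hillPotential_nonneg hb hμ t)]
  exact (hillPotential_lt_two hb hμ t).le

end Potential

theorem IsPruferAngle.add_pi {q θ : ℝ → ℝ} (h : IsPruferAngle q θ) :
    IsPruferAngle q (fun t => θ t + π) := fun t => by
  simpa [cos_add_pi, sin_add_pi] using (h t).add_const π

theorem isPruferAngle_const_pi_div_two {q : ℝ → ℝ} (hq : ∀ t, q t = 0) :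
    IsPruferAngle q (fun _ => π / 2) := fun t => by
  simpa [hq] using hasDerivAt_const t (π / 2)

/-- A Prüfer angle rotating at speed between `0` and `2` that reaches a multiple of `π` at each
multiple of `π` gains exactly `π` each time. -/
theorem IsPruferAngle.apply_mul_pi {q θ : ℝ → ℝ} (h : IsPruferAngle q θ) (hq : ∀ t, 0 < q t)
    (hq2 : ∀ t, q t < 2) (h0 : θ 0 = 0) (hs : ∀ j : ℕ, sin (θ (π * j)) = 0) (j : ℕ) :
    θ (π * j) = j * π := by
  have hd : ∀ t, deriv θ t < 2 := by
    intro t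
    rw [(h t).deriv]
    nlinarith [sin_sq_add_cos_sq (θ t), hq2 t, sq_nonneg (sin (θ t)), sq_nonneg (cos (θ t)),
      mul_nonneg (sq_nonneg (sin (θ t))) (sub_nonneg.2 (hq2 t).le)]
  induction j with
  | zero => simp [h0]
  | succ j ih =>
    have hlt : π * j < π * (j + 1 : ℕ) := by push_cast; linarith [pi_pos]
    have h1 := h.strictMono hq hlt
    have h2 := image_sub_lt_mul_sub_of_deriv_lt (fun t => (h t).differentiableAt) hd hlt
    obtain ⟨n, hn⟩ := sin_eq_zero_iff.1 (hs (j + 1))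
    rw [← hn, ih] at h1 h2
    have h3 : (j : ℝ) < n := lt_of_mul_lt_mul_right h1 pi_pos.le
    have h4 : (n : ℝ) < j + 2 := by
      refine lt_of_mul_lt_mul_right (a := π) ?_ pi_pos.le
      push_cast at h2
      linarith
    have h3' : (j : ℤ) < n := by exact_mod_cast h3
    have h4' : n < (j : ℤ) + 2 := by exact_mod_cast h4
    obtain rfl : n = j + 1 := by omega
    rw [← hn]
    push_cast
    ring

theorem IsPruferAngle.le_apply_mul_pi {q θ : ℝ → ℝ} (h : IsPruferAngle q θ) (hq : ∀ t, 0 < q t)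
    (h0 : θ 0 = π / 2) (hs : ∀ j : ℕ, cos (θ (π * j)) = 0) (j : ℕ) :
    π / 2 + j * π ≤ θ (π * j) := by
  induction j with
  | zero => simp [h0]
  | succ j ih =>
    have hlt : π * j < π * (j + 1 : ℕ) := by push_cast; linarith [pi_pos]
    have h1 := h.strictMono hq hlt
    obtain ⟨n, hn⟩ := cos_eq_zero_iff.1 (hs (j + 1))
    rw [hn] at h1 ⊢
    have h3 : (j : ℝ) < n := lt_of_mul_lt_mul_right (a := π) (by linarith) pi_pos.le
    have h3' : (j : ℤ) + 1 ≤ n := by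
      have : (j : ℤ) < n := by exact_mod_cast h3
      omega
    have h4 : (j : ℝ) + 1 ≤ n := by exact_mod_cast h3'
    push_cast
    nlinarith [pi_pos]

/-- Transfer of the crossing count from `μ = 1 / (γ + λ)` to `λ > 0`. -/
theorem ncard_lattice_crossings_inv {f : ℝ → ℝ} {γ c : ℝ} {M : ℕ} (hγ : 0 < γ)
    (hf : ContinuousOn f (Icc 0 γ⁻¹)) (hm : StrictMonoOn f (Icc 0 γ⁻¹)) (ha : c ≤ f 0)
    (ha' : f 0 < c + π) (hb : c + M * π < f γ⁻¹) (hb' : f γ⁻¹ ≤ c + (M + 1) * π) :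
    {lam : ℝ | 0 < lam ∧ ∃ n : ℤ, f (γ + lam)⁻¹ = c + n * π}.Finite ∧
      {lam : ℝ | 0 < lam ∧ ∃ n : ℤ, f (γ + lam)⁻¹ = c + n * π}.ncard = M := by
  obtain ⟨h1, h2⟩ := ncard_lattice_crossings (inv_pos.2 hγ).le hf hm ha ha' hb hb'
  have himage : {lam : ℝ | 0 < lam ∧ ∃ n : ℤ, f (γ + lam)⁻¹ = c + n * π} =
      (fun μ => μ⁻¹ - γ) '' {x | x ∈ Ioo 0 γ⁻¹ ∧ ∃ n : ℤ, f x = c + n * π} := by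
    ext lam
    simp only [Set.mem_ofPred_eq, Set.mem_image]
    constructor
    · rintro ⟨hl, hn⟩
      refine ⟨(γ + lam)⁻¹, ⟨⟨by positivity, ?_⟩, hn⟩, by simp⟩
      exact inv_strictAnti₀ hγ (by linarith)
    · rintro ⟨μ, ⟨⟨hμ0, hμ⟩, hn⟩, rfl⟩
      refine ⟨?_, by simpa using hn⟩
      rw [sub_pos]
      exact (lt_inv_comm₀ hμ0 hγ).1 hμ
  rw [himage]
  refine ⟨h1.image _, ?_⟩
  rw [Set.ncard_image_of_injective _ fun x y hxy => by simpa using hxy, h2]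

section Wave

variable {U : ℝ → ℝ} {γ : ℝ}

/-- The travelling wave equation in first-order form, for `U` and the flux `(γ - U²/2) U'`. -/
theorem hasDerivAt_wave_flux (hU : ContDiff ℝ (⊤ : ℕ∞) U)
    (hode : ∀ z, deriv (fun w => (γ - (1/2) * (U w) ^ 2) * deriv U w) z + U z = 0) (z : ℝ) :
    HasDerivAt U (deriv U z) z ∧
      HasDerivAt (fun w => (γ - (1/2) * (U w) ^ 2) * deriv U w) (-U z) z := by
  have hU' : ContDiff ℝ (⊤ : ℕ∞) (deriv U) := (contDiff_infty_iff_deriv.1 hU).2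
  have hs : ContDiff ℝ (⊤ : ℕ∞) (fun w => (γ - (1/2) * (U w) ^ 2) * deriv U w) := by fun_prop
  refine ⟨(hU.differentiable (by simp) z).hasDerivAt, ?_⟩
  rw [show -U z = deriv (fun w => (γ - (1/2) * (U w) ^ 2) * deriv U w) z by linarith [hode z]]
  exact (hs.differentiable (by simp) z).hasDerivAt

theorem isHillSolution_wave_flux (hU : ContDiff ℝ (⊤ : ℕ∞) U)
    (hode : ∀ z, deriv (fun w => (γ - (1/2) * (U w) ^ 2) * deriv U w) z + U z = 0)
    (hpos : ∀ z, 0 < γ - (1/2) * (U z) ^ 2) :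
    IsHillSolution (fun z => (γ - (1/2) * (U z) ^ 2)⁻¹)
      (fun w => (γ - (1/2) * (U w) ^ 2) * deriv U w) (fun z => -U z) := fun t => by
  have h := hasDerivAt_wave_flux hU hode t
  refine ⟨h.2, ?_⟩
  convert! h.1.neg using 1
  rw [inv_mul_cancel_left₀ (hpos t).ne']

theorem isHillSolution_wave_primitive (hU : ContDiff ℝ (⊤ : ℕ∞) U)
    (hode : ∀ z, deriv (fun w => (γ - (1/2) * (U w) ^ 2) * deriv U w) z + U z = 0)
    (hpos : ∀ z, 0 < γ - (1/6) * (U z) ^ 2) :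
    IsHillSolution (fun z => (γ - (1/6) * (U z) ^ 2)⁻¹)
      (fun z => (γ - (1/6) * (U z) ^ 2) * U z)
      (fun w => (γ - (1/2) * (U w) ^ 2) * deriv U w) := fun t => by
  have h := hasDerivAt_wave_flux hU hode t
  constructor
  · convert! (((h.1.pow 2).const_mul (1/6)).const_sub γ).mul h.1 using 1
    simp
    ring
  · convert! h.2 using 1
    rw [inv_mul_cancel_left₀ (hpos t).ne']

theorem deriv_eq_zero_at_mul_pi (heven : ∀ z, U (-z) = U z)
    (hper : Function.Periodic U (2 * π)) (j : ℕ) : deriv U (π * j) = 0 := by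
  have h1 : deriv U (-(π * j)) = -deriv U (π * j) := by
    have := deriv_comp_neg U (π * j)
    rw [show (fun x => U (-x)) = U from funext heven] at this
    linarith
  have h2 : deriv U (-(π * j) + j * (2 * π)) = deriv U (-(π * j)) := by
    have := deriv_comp_add_const U (j * (2 * π)) (-(π * j))
    rw [show (fun x => U (x + j * (2 * π))) = U from funext (hper.nat_mul j)] at this
    exact this.symm
  rw [show -(π * j) + j * (2 * π) = π * j by ring, h1] at h2
  linarith

theorem wave_apply_zero_ne_zero {w₁ y₁ w₂ y₂ : ℝ → ℝ} (heven : ∀ z, U (-z) = U z)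
    (hU : ContDiff ℝ (⊤ : ℕ∞) U) (hne : ∃ z w : ℝ, U z ≠ U w)
    (hper : Function.Periodic U (2 * π))
    (hode : ∀ z, deriv (fun w => (γ - (1/2) * (U w) ^ 2) * deriv U w) z + U z = 0)
    (hpos : ∀ z, 0 < γ - (1/2) * (U z) ^ 2)
    (F : IsFundamentalPair (fun z => (γ - (1/2) * (U z) ^ 2)⁻¹) w₁ y₁ w₂ y₂) :
    U 0 ≠ 0 ∧ ∀ z, (γ - (1/2) * (U z) ^ 2) * deriv U z = -U 0 * w₁ z := by
  have hU0 : deriv U 0 = 0 := by simpa using deriv_eq_zero_at_mul_pi heven hper 0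
  have hrep : ∀ z, (γ - (1/2) * (U z) ^ 2) * deriv U z = -U 0 * w₁ z := by
    intro z
    have := (F.eq_linear_comb (isHillSolution_wave_flux hU hode hpos) z).1
    simpa [hU0] using this
  refine ⟨fun h0 => ?_, hrep⟩
  obtain ⟨z, w, hzw⟩ := hne
  refine hzw (is_const_of_deriv_eq_zero (hU.differentiable (by simp)) (fun x => ?_) z w)
  have := hrep x
  rw [h0, neg_zero, zero_mul] at this
  exact (mul_eq_zero.1 this).resolve_left (hpos x).ne'

theorem pruferAngle_wave_dirichlet {θ₁ θ₂ : ℝ → ℝ} (heven : ∀ z, U (-z) = U z)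
    (hU : ContDiff ℝ (⊤ : ℕ∞) U) (hne : ∃ z w : ℝ, U z ≠ U w)
    (hper : Function.Periodic U (2 * π))
    (hode : ∀ z, deriv (fun w => (γ - (1/2) * (U w) ^ 2) * deriv U w) z + U z = 0)
    (hpos : ∀ z, 1/2 < γ - (1/2) * (U z) ^ 2)
    (h₁ : IsPruferAngle (fun z => (γ - (1/2) * (U z) ^ 2)⁻¹) θ₁)
    (h₂ : IsPruferAngle (fun z => (γ - (1/2) * (U z) ^ 2)⁻¹) θ₂)
    (h₁0 : θ₁ 0 = 0) (h₂0 : θ₂ 0 = π / 2) (j : ℕ) : θ₁ (π * j) = j * π := by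
  have hpos' : ∀ z, 0 < γ - (1/2) * (U z) ^ 2 := fun z => by linarith [hpos z]
  have hUc := hU.continuous
  have hqc : Continuous fun z => (γ - (1/2) * (U z) ^ 2)⁻¹ :=
    Continuous.inv₀ (by fun_prop) fun z => (hpos' z).ne'
  obtain ⟨w₁, y₁, w₂, y₂, F, hw₁, -⟩ := exists_fundamentalPair hqc h₁ h₂ h₁0 h₂0
  obtain ⟨hU0, hrep⟩ := wave_apply_zero_ne_zero heven hU hne hper hode hpos' F
  refine h₁.apply_mul_pi (fun z => inv_pos.2 (hpos' z)) (fun z => ?_) h₁0 (fun i => ?_) j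
  · rw [inv_lt_comm₀ (hpos' z) two_pos, ← one_div]
    exact hpos z
  · have := hrep (π * i)
    rw [deriv_eq_zero_at_mul_pi heven hper, mul_zero] at this
    exact (hw₁ _).1 ((mul_eq_zero.1 this.symm).resolve_left (neg_ne_zero.2 hU0))

theorem lt_pruferAngle_wave_neumann {θ : ℝ → ℝ} (heven : ∀ z, U (-z) = U z)
    (hU : ContDiff ℝ (⊤ : ℕ∞) U) (hU0 : U 0 ≠ 0)
    (hper : Function.Periodic U (2 * π))
    (hode : ∀ z, deriv (fun w => (γ - (1/2) * (U w) ^ 2) * deriv U w) z + U z = 0)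
    (hpos : ∀ z, 1/2 < γ - (1/2) * (U z) ^ 2)
    (h : IsPruferAngle (fun z => (γ - (1/2) * (U z) ^ 2)⁻¹) θ)
    (h0 : θ 0 = π / 2) {j : ℕ} (hj : 0 < j) : π / 2 + j * π < θ (π * j) := by
  have hpos' : ∀ z, 0 < γ - (1/2) * (U z) ^ 2 := fun z => by linarith [hpos z]
  have hpos6 : ∀ z, 0 < γ - (1/6) * (U z) ^ 2 := fun z => by nlinarith [hpos z, sq_nonneg (U z)]
  have hUc := hU.continuous
  have hqc : Continuous fun z => (γ - (1/2) * (U z) ^ 2)⁻¹ :=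
    Continuous.inv₀ (by fun_prop) fun z => (hpos' z).ne'
  have hqc6 : Continuous fun z => (γ - (1/6) * (U z) ^ 2)⁻¹ :=
    Continuous.inv₀ (by fun_prop) fun z => (hpos6 z).ne'
  have hbd : ∀ z, |((γ - (1/6) * (U z) ^ 2)⁻¹ : ℝ)| ≤ ((2 : ℝ≥0) : ℝ) := by
    intro z
    rw [abs_of_pos (inv_pos.2 (hpos6 z)), NNReal.coe_ofNat]
    refine inv_le_of_inv_le₀ two_pos ?_
    nlinarith [hpos z, sq_nonneg (U z)]
  obtain ⟨φ₁, hφ₁0, hφ₁⟩ := exists_isPruferAngle hqc6 hbd 0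
  obtain ⟨φ₂, hφ₂0, hφ₂⟩ := exists_isPruferAngle hqc6 hbd (π / 2)
  obtain ⟨w₁, y₁, w₂, y₂, F, -, hy₂⟩ := exists_fundamentalPair hqc6 hφ₁ hφ₂ hφ₁0 hφ₂0
  have hcos : ∀ i : ℕ, cos (φ₂ (π * i)) = 0 := by
    intro i
    have hd0 : deriv U 0 = 0 := by simpa using deriv_eq_zero_at_mul_pi heven hper 0
    have := (F.eq_linear_comb (isHillSolution_wave_primitive hU hode hpos6) (π * i)).2
    rw [deriv_eq_zero_at_mul_pi heven hper, hd0, mul_zero, mul_zero, zero_mul, add_zero] at this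
    exact (hy₂ _).1 ((mul_eq_zero.1 this.symm).resolve_left (mul_ne_zero (hpos6 0).ne' hU0))
  refine (hφ₂.le_apply_mul_pi (fun z => inv_pos.2 (hpos6 z)) hφ₂0 hcos j).trans_lt ?_
  have hsq : 0 < (U 0) ^ 2 := by positivity
  refine hφ₂.lt_of_potential_le h hqc6 hqc (fun z => ?_) ?_ (hφ₂0.trans h0.symm)
    (mul_pos pi_pos (by exact_mod_cast hj))
  · exact inv_anti₀ (hpos' z) (by nlinarith [sq_nonneg (U z)])
  · exact inv_strictAnti₀ (hpos' 0) (by linarith)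

end Wave

theorem EigSetL_eq_constrained_pair {U θ₁ θ₂ : ℝ → ℝ} {γ lam : ℝ} {N : ℕ}
    (hU : ContDiff ℝ (⊤ : ℕ∞) U) (heven : ∀ z, U (-z) = U z)
    (hper : Function.Periodic U (2 * π)) (hpos : ∀ z, 0 < γ + lam - (1/2) * (U z) ^ 2)
    (h₁ : IsPruferAngle (fun z => (γ + lam - (1/2) * (U z) ^ 2)⁻¹) θ₁)
    (h₂ : IsPruferAngle (fun z => (γ + lam - (1/2) * (U z) ^ 2)⁻¹) θ₂)
    (h₁0 : θ₁ 0 = 0) (h₂0 : θ₂ 0 = π / 2) :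
    ∃ e₁ e₂ : ℝ → ℝ, LinearIndependent ℝ ![e₁, e₂] ∧
      EigSetL U γ lam N = {v | ∃ a b : ℝ,
        (¬ (∃ n : ℤ, θ₂ (π * N) = π / 2 + n * π) → a = 0) ∧
        (¬ (∃ n : ℤ, θ₁ (π * N) = 0 + n * π) → b = 0) ∧ v = a • e₁ + b • e₂} := by
  have hUc := hU.continuous
  have hqc : Continuous fun z => (γ + lam - (1/2) * (U z) ^ 2)⁻¹ :=
    Continuous.inv₀ (by fun_prop) fun z => (hpos z).ne'
  obtain ⟨w₁, y₁, w₂, y₂, F, hw₁, hy₂⟩ := exists_fundamentalPair hqc h₁ h₂ h₁0 h₂0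
  refine ⟨_, _, F.linearIndependent fun z => (inv_pos.2 (hpos z)).ne', ?_⟩
  have e1 : w₁ (π * N) = 0 ↔ ∃ n : ℤ, θ₁ (π * N) = 0 + n * π := by
    rw [hw₁, sin_eq_zero_iff]
    simp only [zero_add, eq_comm]
  have e2 : y₂ (π * N) = 0 ↔ ∃ n : ℤ, θ₂ (π * N) = π / 2 + n * π := by
    rw [hy₂, cos_eq_zero_iff]
    refine exists_congr fun n => ?_
    rw [show (2 * (n : ℝ) + 1) * π / 2 = π / 2 + n * π by ring]
  rw [EigSetL_eq hU heven hper hpos (fun _ => rfl) F, e1, e2]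

open Classical in
theorem sum_indicator_eq_ncard_add_ncard {s : Finset ℝ} {P Q : ℝ → Prop} {R : ℝ → Prop}
    (hs : ∀ x, x ∈ s ↔ R x ∧ (P x ∨ Q x)) :
    ∑ x ∈ s, ((if P x then 1 else 0) + (if Q x then 1 else 0)) =
      {x | R x ∧ P x}.ncard + {x | R x ∧ Q x}.ncard := by
  have h1 : {x | R x ∧ P x} = (s.filter P : Finset ℝ) := by
    ext x
    simp only [Set.mem_ofPred_eq, Finset.coe_filter, hs]
    tauto
  have h2 : {x | R x ∧ Q x} = (s.filter Q : Finset ℝ) := by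
    ext x
    simp only [Set.mem_ofPred_eq, Finset.coe_filter, hs]
    tauto
  rw [h1, h2, Set.ncard_coe_finset, Set.ncard_coe_finset, Finset.sum_add_distrib,
    Finset.sum_boole, Finset.sum_boole]
  rfl

end

theorem spectrum_L_modified_reduced_ostrovsky :
    ∃ ε > (0:ℝ), ∀ N : ℕ, 1 ≤ N → ∀ γ ∈ Set.Ioo (1:ℝ) (1 + ε), ∀ U : ℝ → ℝ,
      (∀ z : ℝ, U (-z) = U z) → ContDiff ℝ (⊤ : ℕ∞) U → (∃ z w : ℝ, U z ≠ U w) →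
      Function.Periodic U (2 * π) →
      (∀ z : ℝ,
        deriv (fun w => (γ - (1/2) * (U w) ^ 2) * deriv U w) z + U z = 0) →
      (∀ z : ℝ, |U z| ≤ ε) →
      (∃ hfin : Set.Finite {lam : ℝ | 0 < lam ∧ ∃ v ∈ EigSetL U γ lam N, v ≠ 0},
        (∑ lam ∈ hfin.toFinset,
          Module.finrank ℝ (Submodule.span ℝ (EigSetL U γ lam N))) = 2 * N - 1) ∧
      (EigSetL U γ 0 N = {v | ∃ c : ℝ, v = fun z => c * deriv U z} ∧ deriv U ≠ 0) := by
  classical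
  refine ⟨1/2, by norm_num, ?_⟩
  intro N hN γ hγ U heven hU hne hper hode hb
  have hUc := hU.continuous
  have hsq : ∀ z, (U z) ^ 2 ≤ 1/4 := fun z => by
    have := abs_le.1 (hb z)
    nlinarith [this.1, this.2]
  have hγ0 : 0 < γ := by linarith [hγ.1]
  have hpos : ∀ lam, 0 ≤ lam → ∀ z, 1/2 < γ + lam - (1/2) * (U z) ^ 2 := fun lam hl z => by
    linarith [hsq z, hγ.1]
  have hpos0 : ∀ z, 1/2 < γ - (1/2) * (U z) ^ 2 := fun z => by linarith [hsq z, hγ.1]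
  have hmem : ∀ lam, 0 ≤ lam → (γ + lam)⁻¹ ∈ Set.Icc (0:ℝ) 1 := fun lam hl =>
    ⟨inv_nonneg.2 (by linarith), inv_le_one_of_one_le₀ (by linarith [hγ.1])⟩
  have hmem0 : γ⁻¹ ∈ Set.Icc (0:ℝ) 1 := by simpa using hmem 0 le_rfl
  have hzero : (0:ℝ) ∈ Set.Icc (0:ℝ) 1 := ⟨le_rfl, zero_le_one⟩
  have hsub : Set.Icc (0:ℝ) γ⁻¹ ⊆ Set.Icc 0 1 := Set.Icc_subset_Icc_right hmem0.2
  have hN0 : (0:ℝ) < N := by exact_mod_cast hN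
  have hh : 0 < π * N := mul_pos pi_pos hN0
  have hpot : ∀ lam, 0 ≤ lam → hillPotential U (γ + lam)⁻¹ =
      fun z => (γ + lam - (1/2) * (U z) ^ 2)⁻¹ := fun lam hl =>
    funext fun z => hillPotential_eq_inv (by linarith) z
  have hpot0 : hillPotential U γ⁻¹ = fun z => (γ - (1/2) * (U z) ^ 2)⁻¹ := by
    simpa using hpot 0 le_rfl
  have hzeropot : ∀ z, hillPotential U 0 z = 0 := fun z => by simp [hillPotential]
  obtain ⟨θ, hθ⟩ := exists_pruferAngle_hillPotential hUc hb 0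
  obtain ⟨φ, hφ⟩ := exists_pruferAngle_hillPotential hUc hb (π / 2)
  have hθγ := (hθ _ hmem0).2
  have hφγ := (hφ _ hmem0).2
  have hupper : φ γ⁻¹ (π * N) < θ γ⁻¹ (π * N) + π :=
    hφγ.lt_of_lt hθγ.add_pi (continuous_hillPotential hUc hb hmem0) (s := 0)
      (by simp only [(hθ _ hmem0).1, (hφ _ hmem0).1]; linarith [pi_pos]) _
  rw [hpot0] at hθγ hφγ
  have hθN : θ γ⁻¹ (π * N) = N * π := pruferAngle_wave_dirichlet heven hU hne hper hode hpos0
    hθγ hφγ (hθ _ hmem0).1 (hφ _ hmem0).1 N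
  obtain ⟨w₁, y₁, w₂, y₂, F, hw₁, hy₂⟩ := exists_fundamentalPair
    (by rw [← hpot0]; exact continuous_hillPotential hUc hb hmem0) hθγ hφγ
    (hθ _ hmem0).1 (hφ _ hmem0).1
  obtain ⟨hU0, hrep⟩ := wave_apply_zero_ne_zero heven hU hne hper hode
    (fun z => by linarith [hpos0 z]) F
  have hlower : π / 2 + N * π < φ γ⁻¹ (π * N) := lt_pruferAngle_wave_neumann heven hU hU0 hper
    hode hpos0 hφγ (hφ _ hmem0).1 hN
  have hθ0 : 0 ≤ θ 0 (π * N) := by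
    have hmono : Monotone (θ 0) := by
      refine monotone_of_deriv_nonneg (fun t => ((hθ 0 hzero).2 t).differentiableAt) fun t => ?_
      rw [((hθ 0 hzero).2 t).deriv, hzeropot]
      positivity
    have := hmono hh.le
    rwa [(hθ 0 hzero).1] at this
  have hθ0' : θ 0 (π * N) < π / 2 :=
    (hθ 0 hzero).2.lt_of_lt (isPruferAngle_const_pi_div_two hzeropot)
      (continuous_hillPotential hUc hb hzero) (s := 0)
      (by rw [(hθ 0 hzero).1]; linarith [pi_pos]) _
  have hφ0 : φ 0 (π * N) = π / 2 :=
    (hφ 0 hzero).2.eq_of_eq (isPruferAngle_const_pi_div_two hzeropot)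
      (continuous_hillPotential hUc hb hzero) (s := 0) (hφ 0 hzero).1 _
  have hcountθ := ncard_lattice_crossings_inv (c := 0) (M := N - 1) hγ0
    ((continuousOn_pruferAngle_hillPotential hb hθ hh.le).mono hsub)
    ((strictMonoOn_pruferAngle_hillPotential hUc hb hθ hh).mono hsub)
    hθ0 (by linarith [pi_pos])
    (by rw [hθN]; push_cast [Nat.cast_sub hN]; linarith [pi_pos])
    (by rw [hθN]; push_cast [Nat.cast_sub hN]; linarith [pi_pos])
  have hcountφ := ncard_lattice_crossings_inv (c := π / 2) (M := N) hγ0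
    ((continuousOn_pruferAngle_hillPotential hb hφ hh.le).mono hsub)
    ((strictMonoOn_pruferAngle_hillPotential hUc hb hφ hh).mono hsub)
    hφ0.ge (by linarith [pi_pos]) hlower (by linarith [pi_pos])
  have hstruct : ∀ lam, 0 ≤ lam → ∃ e₁ e₂ : ℝ → ℝ, LinearIndependent ℝ ![e₁, e₂] ∧
      EigSetL U γ lam N = {v | ∃ a b : ℝ,
        (¬ (∃ n : ℤ, φ (γ + lam)⁻¹ (π * N) = π / 2 + n * π) → a = 0) ∧
        (¬ (∃ n : ℤ, θ (γ + lam)⁻¹ (π * N) = 0 + n * π) → b = 0) ∧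
        v = a • e₁ + b • e₂} := by
    intro lam hl
    have h1 := (hθ _ (hmem lam hl)).2
    have h2 := (hφ _ (hmem lam hl)).2
    rw [hpot lam hl] at h1 h2
    exact EigSetL_eq_constrained_pair hU heven hper (fun z => by linarith [hpos lam hl z])
      h1 h2 (hθ _ (hmem lam hl)).1 (hφ _ (hmem lam hl)).1
  have hset : ∀ lam, (0 < lam ∧ ∃ v ∈ EigSetL U γ lam N, v ≠ 0) ↔ 0 < lam ∧
      ((∃ n : ℤ, φ (γ + lam)⁻¹ (π * N) = π / 2 + n * π) ∨
        ∃ n : ℤ, θ (γ + lam)⁻¹ (π * N) = 0 + n * π) := by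
    intro lam
    refine and_congr_right fun hl => ?_
    obtain ⟨e₁, e₂, hli, heq⟩ := hstruct lam hl.le
    rw [heq]
    exact exists_ne_zero_constrained_pair_iff hli _ _
  refine ⟨?_, ?_, ?_⟩
  · have hfin : Set.Finite {lam : ℝ | 0 < lam ∧ ∃ v ∈ EigSetL U γ lam N, v ≠ 0} := by
      refine (hcountφ.1.union hcountθ.1).subset fun lam hlam => ?_
      obtain ⟨hl, h | h⟩ := (hset lam).1 hlam
      · exact Or.inl ⟨hl, h⟩
      · exact Or.inr ⟨hl, h⟩
    refine ⟨hfin, ?_⟩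
    have hterm : ∀ lam ∈ hfin.toFinset,
        Module.finrank ℝ (Submodule.span ℝ (EigSetL U γ lam N)) =
          (if (∃ n : ℤ, φ (γ + lam)⁻¹ (π * N) = π / 2 + n * π) then 1 else 0) +
          (if (∃ n : ℤ, θ (γ + lam)⁻¹ (π * N) = 0 + n * π) then 1 else 0) := by
      intro lam hlam
      rw [Set.Finite.mem_toFinset] at hlam
      obtain ⟨e₁, e₂, hli, heq⟩ := hstruct lam hlam.1.le
      rw [heq]
      exact finrank_span_constrained_pair hli _ _
    rw [Finset.sum_congr rfl hterm, sum_indicator_eq_ncard_add_ncard (R := fun lam => 0 < lam)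
      (fun lam => by rw [Set.Finite.mem_toFinset]; exact hset lam), hcountφ.2, hcountθ.2]
    omega
  · have hq0 : ∀ z, 0 < γ + 0 - (1/2) * (U z) ^ 2 := fun z => by linarith [hpos 0 le_rfl z]
    have hy : y₂ (π * N) ≠ 0 := by
      rw [Ne, hy₂, cos_eq_zero_iff]
      rintro ⟨n, hn⟩
      rw [hn] at hlower hupper
      rw [hθN] at hupper
      have h1 : (N : ℝ) < n := lt_of_mul_lt_mul_right (by linarith) pi_pos.le
      have h2 : (n : ℝ) < N + 1 := lt_of_mul_lt_mul_right (by linarith [pi_pos]) pi_pos.le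
      have h1' : (N : ℤ) < n := by exact_mod_cast h1
      have h2' : n < (N : ℤ) + 1 := by exact_mod_cast h2
      omega
    have hw : w₁ (π * N) = 0 := by rw [hw₁, hθN, sin_nat_mul_pi]
    have hderiv : ∀ z, deriv U z = U 0 * (-(γ - (1/2) * (U z) ^ 2)⁻¹ * w₁ z) := fun z => by
      have hz : γ - (1/2) * (U z) ^ 2 ≠ 0 := by linarith [hpos0 z]
      refine mul_left_cancel₀ hz ((hrep z).trans ?_)
      rw [mul_left_comm, ← mul_assoc (γ - _), mul_neg, mul_inv_cancel₀ hz]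
      ring
    rw [EigSetL_eq hU heven hper hq0 (q := fun z => (γ - (1/2) * (U z) ^ 2)⁻¹)
      (fun _ => by rw [add_zero]) F]
    ext v
    constructor
    · rintro ⟨a, b, ha, -, rfl⟩
      refine ⟨b / U 0, funext fun z => ?_⟩
      rw [hderiv z, ← mul_assoc, div_mul_cancel₀ _ hU0, ha hy]
      simp
    · rintro ⟨c, rfl⟩
      refine ⟨0, c * U 0, fun _ => rfl, fun h => absurd hw h, funext fun z => ?_⟩
      rw [hderiv z]
      simp [mul_assoc]
  · intro h
    obtain ⟨z, w, hzw⟩ := hne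
    exact hzw (is_const_of_deriv_eq_zero (hU.differentiable (by simp)) (congrFun h) z w)
end

section
/- There exists ε > 0 with the following property. Let N ≥ 1 be an integer, let γ ∈ (1, 1+ε), and let U : ℝ → ℝ be an even, smooth, nonconstant, 2π-periodic solution of ((γ − (1/2)·U(z)²)·U'(z))' + U(z) = 0 with sup_{z∈ℝ} |U(z)| ≤ ε, and assume additionally |U'(z)| < 1 for all z (which holds automatically once ε is small enough); let I denote the constant value of the first-order invariant. For λ ∈ ℝ, let E_λ be the real vector space of smooth 2πN-periodic functions v : ℝ → ℝ with ∫₀^{2πN} v = 0 satisfying (1/2)·(γ² − 2I)^{−1/2}·v(z) + (1/2)·( (1 − U'(z)²)^{−3/2}·v'(z) )' = λ·v(z) for all z ∈ ℝ. Then: (i) the set of λ > 0 with E_λ ≠ {0} is finite, and the sum of dim E_λ over these λ equals 2N − 2; (ii) E₀ is one-dimensional and is spanned by U'; (iii) the set of λ < 0 with E_λ ≠ {0} is infinite. -/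
open Real

/-- The eigenspace `E_λ`: smooth `2πN`-periodic zero-mean solutions `v` of
`(1/2)(γ² − 2I)^{−1/2} v + (1/2)((1 − (U')²)^{−3/2} v')' = λ v`, i.e. `M_γ v = λ v`. -/
def EigSetM (U : ℝ → ℝ) (γ I lam : ℝ) (N : ℕ) : Set (ℝ → ℝ) :=
  {v | ContDiff ℝ (⊤ : ℕ∞) v ∧ Function.Periodic v (2 * π * N) ∧
    (∫ z in (0:ℝ)..(2 * π * N), v z) = 0 ∧
    ∀ z : ℝ,
      (1/2) * (γ ^ 2 - 2 * I) ^ (-(1:ℝ)/2) * v z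
        + (1/2) * deriv (fun w => (1 - (deriv U w) ^ 2) ^ (-(3:ℝ)/2) * deriv v w) z
        = lam * v z}

/-- A time-dependent vector field that is bounded, continuous in time and uniformly Lipschitz in
space has a global integral curve through every point. -/
theorem exists_global_solution_of_bounded {f : ℝ → ℝ → ℝ} {K L : NNReal}
    (hlip : ∀ t, LipschitzWith K (f t)) (hcont : ∀ x, Continuous fun t => f t x)
    (hbd : ∀ t x, |f t x| ≤ L) (x₀ : ℝ) :
    ∃ α : ℝ → ℝ, α 0 = x₀ ∧ ∀ t, HasDerivAt α (f t (α t)) t := by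
  have hloc : ∀ n : ℕ, ∃ α : ℝ → ℝ, α 0 = x₀ ∧
      ∀ t ∈ Set.Ioo (-(n + 1 : ℝ)) (n + 1), HasDerivAt α (f t (α t)) t := by
    intro n
    have h0 : (0 : ℝ) ∈ Set.Icc (-(n + 1 : ℝ)) (n + 1) := by
      constructor <;> linarith [(Nat.cast_nonneg n : (0 : ℝ) ≤ n)]
    have hPL : IsPicardLindelof f (⟨0, h0⟩ : Set.Icc (-(n + 1 : ℝ)) (n + 1)) x₀
        (L * (n + 1)) 0 L K := by
      refine ⟨fun t _ => (hlip t).lipschitzOnWith, fun x _ => (hcont x).continuousOn,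
        fun t _ x _ => hbd t x, ?_⟩
      simp
    obtain ⟨α, hα0, hα⟩ := hPL.exists_eq_forall_mem_Icc_hasDerivWithinAt₀
    exact ⟨α, hα0, fun t ht =>
      (hα t (Set.Ioo_subset_Icc_self ht)).hasDerivAt (Icc_mem_nhds ht.1 ht.2)⟩
  choose α hα0 hα using hloc
  have hagree : ∀ m n : ℕ, m ≤ n → Set.EqOn (α m) (α n) (Set.Ioo (-(m + 1 : ℝ)) (m + 1)) := by
    intro m n hmn
    have hmn' : (m : ℝ) ≤ n := by exact_mod_cast hmn
    refine ODE_solution_unique_of_mem_Ioo (v := f) (s := fun _ => Set.univ) (K := K) (t₀ := 0)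
      (fun t _ => (hlip t).lipschitzOnWith) ?_ (fun t ht => ⟨hα m t ht, trivial⟩)
      (fun t ht => ⟨hα n t ⟨by linarith [ht.1], by linarith [ht.2]⟩, trivial⟩)
      ((hα0 m).trans (hα0 n).symm)
    constructor <;> linarith [(Nat.cast_nonneg m : (0 : ℝ) ≤ m)]
  have hkey : ∀ (n : ℕ) (t : ℝ), |t| < n + 1 → α ⌈|t|⌉₊ t = α n t := by
    intro n t ht
    have h1 : |t| < (⌈|t|⌉₊ : ℝ) + 1 := by linarith [Nat.le_ceil |t|]
    rcases le_total ⌈|t|⌉₊ n with h | h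
    · exact hagree _ _ h (abs_lt.mp h1)
    · exact (hagree _ _ h (abs_lt.mp ht)).symm
  refine ⟨fun t => α ⌈|t|⌉₊ t, by simp [hα0], fun t => ?_⟩
  have h1 : |t| < (⌈|t|⌉₊ : ℝ) + 1 := by linarith [Nat.le_ceil |t|]
  refine (hα ⌈|t|⌉₊ t (abs_lt.mp h1)).congr_of_eventuallyEq ?_
  filter_upwards [continuous_abs.continuousAt.eventually_lt_const h1] with s hs
  exact hkey _ _ hs

/-- The Prüfer vector field of the system `v' = ω P u`, `u' = -ω v`. -/
noncomputable def prueferField (P : ℝ → ℝ) (ω z θ : ℝ) : ℝ :=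
  ω * (P z * cos θ ^ 2 + sin θ ^ 2)

theorem prueferField_factor_bounds {p m M : ℝ} (hp : m ≤ p ∧ p ≤ M) (hm : 0 < m) (θ : ℝ) :
    min m 1 ≤ p * cos θ ^ 2 + sin θ ^ 2 ∧ p * cos θ ^ 2 + sin θ ^ 2 ≤ M + 1 := by
  have h := sin_sq_add_cos_sq θ
  have h1 := min_le_left m 1
  have h2 := min_le_right m 1
  constructor <;> nlinarith [sq_nonneg (sin θ), sq_nonneg (cos θ)]

theorem lipschitzWith_prueferField {P : ℝ → ℝ} {m M : ℝ} (hP : ∀ z, m ≤ P z ∧ P z ≤ M)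
    (hm : 0 < m) (ω z : ℝ) :
    LipschitzWith (Real.toNNReal (|ω| * (2 * (1 + M)))) (prueferField P ω z) := by
  have hM : 0 ≤ M := by linarith [(hP 0).1, (hP 0).2]
  refine LipschitzWith.of_dist_le_mul fun x y => ?_
  rw [Real.coe_toNNReal _ (by positivity), Real.dist_eq, Real.dist_eq]
  have hs : |sin x - sin y| ≤ |x - y| := by
    have := Real.lipschitzWith_sin.dist_le_mul x y
    simpa [Real.dist_eq] using this
  have e : prueferField P ω z x - prueferField P ω z y
      = ω * ((1 - P z) * ((sin x - sin y) * (sin x + sin y))) := by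
    simp only [prueferField, cos_sq']
    ring
  rw [e, abs_mul, abs_mul, abs_mul, mul_assoc]
  refine mul_le_mul_of_nonneg_left ?_ (abs_nonneg _)
  have h1 : |1 - P z| ≤ 1 + M := by
    rw [abs_le]; constructor <;> linarith [(hP z).1, (hP z).2]
  have h2 : |sin x + sin y| ≤ 2 := by
    rw [abs_le]
    constructor <;> linarith [neg_one_le_sin x, neg_one_le_sin y, sin_le_one x, sin_le_one y]
  calc |1 - P z| * (|sin x - sin y| * |sin x + sin y|)
      ≤ (1 + M) * (|x - y| * 2) := by gcongr
    _ = 2 * (1 + M) * |x - y| := by ring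

theorem exists_pruefer {P : ℝ → ℝ} {m M : ℝ} (hPc : Continuous P) (hP : ∀ z, m ≤ P z ∧ P z ≤ M)
    (hm : 0 < m) (ω θ₀ : ℝ) :
    ∃ θ : ℝ → ℝ, θ 0 = θ₀ ∧ ∀ z, HasDerivAt θ (prueferField P ω z (θ z)) z := by
  have hM : 0 ≤ M := by linarith [(hP 0).1, (hP 0).2]
  refine exists_global_solution_of_bounded (lipschitzWith_prueferField hP hm ω)
    (L := Real.toNNReal (|ω| * (M + 1))) ?_ ?_ θ₀
  · intro x
    unfold prueferField
    fun_prop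
  · intro t x
    rw [Real.coe_toNNReal _ (by positivity), prueferField, abs_mul]
    have h := prueferField_factor_bounds (hP t) hm x
    have h0 : 0 < min m 1 := lt_min hm one_pos
    rw [abs_of_nonneg (h0.le.trans h.1)]
    exact mul_le_mul_of_nonneg_left h.2 (abs_nonneg _)

/-- Two Prüfer angles with the same initial value are strictly ordered by the frequency. -/
theorem pruefer_lt_of_lt {P : ℝ → ℝ} {m M : ℝ} (hP : ∀ z, m ≤ P z ∧ P z ≤ M)
    (hm : 0 < m) {ω₁ ω₂ : ℝ} (hω : ω₁ < ω₂) {θ₁ θ₂ : ℝ → ℝ} (h0 : θ₁ 0 = θ₂ 0)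
    (h₁ : ∀ z, HasDerivAt θ₁ (prueferField P ω₁ z (θ₁ z)) z)
    (h₂ : ∀ z, HasDerivAt θ₂ (prueferField P ω₂ z (θ₂ z)) z) {z : ℝ} (hz : 0 < z) :
    θ₁ z < θ₂ z := by
  have hlt : ∀ x, θ₁ x = θ₂ x → prueferField P ω₁ x (θ₁ x) < prueferField P ω₂ x (θ₂ x) := by
    intro x hx
    rw [hx]
    exact mul_lt_mul_of_pos_right hω
      ((lt_min hm one_pos).trans_le (prueferField_factor_bounds (hP x) hm _).1)
  have hle : ∀ x, 0 ≤ x → θ₁ x ≤ θ₂ x := fun x hx =>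
    image_le_of_deriv_right_lt_deriv_boundary (a := 0) (b := x)
      (HasDerivAt.continuousOn fun y _ => h₁ y) (fun y _ => (h₁ y).hasDerivWithinAt) h0.le h₂
      (fun y _ hy => hlt y hy) ⟨hx, le_rfl⟩
  refine lt_of_le_of_ne (hle z hz.le) fun heq => ?_
  have hmin : IsLocalMin (fun x => θ₂ x - θ₁ x) z := by
    filter_upwards [lt_mem_nhds hz] with x hx
    rw [heq, sub_self]
    linarith [hle x hx.le]
  have := hmin.hasDerivAt_eq_zero ((h₂ z).sub (h₁ z))
  linarith [hlt z heq]

theorem continuous_pruefer_frequency {P : ℝ → ℝ} {m M : ℝ} (hP : ∀ z, m ≤ P z ∧ P z ≤ M)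
    (hm : 0 < m) {Θ : ℝ → ℝ → ℝ} {θ₀ : ℝ} (h0 : ∀ ω, Θ ω 0 = θ₀)
    (h : ∀ ω z, HasDerivAt (Θ ω) (prueferField P ω z (Θ ω z)) z) {z : ℝ} (hz : 0 ≤ z) :
    Continuous fun ω => Θ ω z := by
  have hM : 0 ≤ M := by linarith [(hP 0).1, (hP 0).2]
  rw [continuous_iff_continuousAt]
  intro ω₀
  have hbound : ∀ ω, dist (Θ ω z) (Θ ω₀ z) ≤
      gronwallBound 0 (Real.toNNReal (|ω₀| * (2 * (1 + M)))) (|ω - ω₀| * (M + 1)) z := by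
    intro ω
    have := dist_le_of_approx_trajectories_ODE (a := 0) (b := z) (δ := 0)
      (εf := |ω - ω₀| * (M + 1)) (εg := 0)
      (lipschitzWith_prueferField hP hm ω₀) (HasDerivAt.continuousOn fun y _ => h ω y)
      (fun y _ => (h ω y).hasDerivWithinAt) (fun y _ => ?_)
      (HasDerivAt.continuousOn fun y _ => h ω₀ y)
      (fun y _ => (h ω₀ y).hasDerivWithinAt) (fun y _ => by simp) (by simp [h0]) z ⟨hz, le_rfl⟩
    · simpa using this
    · have hb := prueferField_factor_bounds (hP y) hm (Θ ω y)
      rw [Real.dist_eq, prueferField, prueferField, ← sub_mul, abs_mul,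
        abs_of_nonneg ((lt_min hm one_pos).le.trans hb.1)]
      exact mul_le_mul_of_nonneg_left hb.2 (abs_nonneg _)
  rw [ContinuousAt, tendsto_iff_dist_tendsto_zero]
  refine squeeze_zero (fun _ => dist_nonneg) hbound ?_
  have hc : Continuous fun ω => gronwallBound 0 (Real.toNNReal (|ω₀| * (2 * (1 + M))))
      (|ω - ω₀| * (M + 1)) z :=
    (gronwallBound_continuous_ε _ _ _).comp (by fun_prop)
  simpa [gronwallBound_ε0_δ0] using hc.tendsto ω₀

/-- `(v, u)` solves `v' = ω P u`, `u' = -ω v`, the first-order form of `(P⁻¹ v')' = -ω² v`. -/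
def IsSturmSolution (P : ℝ → ℝ) (ω : ℝ) (v u : ℝ → ℝ) : Prop :=
  ∀ z, HasDerivAt v (ω * (P z * u z)) z ∧ HasDerivAt u (-(ω * v z)) z

namespace IsSturmSolution

variable {P v u v₁ u₁ v₂ u₂ : ℝ → ℝ} {ω : ℝ}

theorem wronskian_eq (h₁ : IsSturmSolution P ω v₁ u₁) (h₂ : IsSturmSolution P ω v₂ u₂)
    (z w : ℝ) : v₁ z * u₂ z - u₁ z * v₂ z = v₁ w * u₂ w - u₁ w * v₂ w := by
  have hd : ∀ x, HasDerivAt (fun x => v₁ x * u₂ x - u₁ x * v₂ x) 0 x := fun x => by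
    refine (((h₁ x).1.mul (h₂ x).2).sub ((h₁ x).2.mul (h₂ x).1)).congr_deriv ?_
    ring
  exact is_const_of_deriv_eq_zero (fun x => (hd x).differentiableAt) (fun x => (hd x).deriv) z w

theorem contDiff (hP : ContDiff ℝ (⊤ : ℕ∞) P) (h : IsSturmSolution P ω v u) :
    ContDiff ℝ (⊤ : ℕ∞) v ∧ ContDiff ℝ (⊤ : ℕ∞) u := by
  have hv : deriv v = fun z => ω * (P z * u z) := funext fun z => (h z).1.deriv
  have hu : deriv u = fun z => -(ω * v z) := funext fun z => (h z).2.deriv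
  have key : ∀ n : ℕ, ContDiff ℝ n v ∧ ContDiff ℝ n u := by
    intro n
    induction n with
    | zero =>
      constructor
      · exact contDiff_zero.2 (continuous_iff_continuousAt.2 fun z => (h z).1.continuousAt)
      · exact contDiff_zero.2 (continuous_iff_continuousAt.2 fun z => (h z).2.continuousAt)
    | succ n ih =>
      have hPn : ContDiff ℝ n P := hP.of_le (by exact_mod_cast le_top)
      push_cast
      rw [contDiff_succ_iff_deriv, contDiff_succ_iff_deriv, hv, hu]
      exact ⟨⟨fun z => (h z).1.differentiableAt, by simp,
        contDiff_const.mul (hPn.mul ih.2)⟩,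
        fun z => (h z).2.differentiableAt, by simp, (contDiff_const.mul ih.1).neg⟩
  exact ⟨contDiff_infty.2 fun n => (key n).1, contDiff_infty.2 fun n => (key n).2⟩

/-- Every solution is a combination of the two normalised fundamental solutions. -/
theorem eq_combination (h₁ : IsSturmSolution P ω v₁ u₁) (h₂ : IsSturmSolution P ω v₂ u₂)
    (hv₁ : v₁ 0 = 1) (hu₁ : u₁ 0 = 0) (hv₂ : v₂ 0 = 0) (hu₂ : u₂ 0 = 1)
    (h : IsSturmSolution P ω v u) (z : ℝ) :
    v z = v 0 * v₁ z + u 0 * v₂ z ∧ u z = v 0 * u₁ z + u 0 * u₂ z := by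
  have e12 := wronskian_eq h₁ h₂ z 0
  have e1 := wronskian_eq h h₁ z 0
  have e2 := wronskian_eq h h₂ z 0
  rw [hv₁, hu₁, hv₂, hu₂] at e12
  rw [hv₁, hu₁] at e1
  rw [hv₂, hu₂] at e2
  constructor
  · linear_combination (-v z) * e12 + v₁ z * e2 - v₂ z * e1
  · linear_combination (-u z) * e12 + u₁ z * e2 - u₂ z * e1

theorem reflect (hP : ∀ z, P (-z) = P z) (h : IsSturmSolution P ω v u) :
    IsSturmSolution P ω (fun z => v (-z)) (fun z => -u (-z)) := by
  intro z
  constructor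
  · refine ((h (-z)).1.scomp z (hasDerivAt_neg z)).congr_deriv ?_
    rw [hP]; simp
  · refine ((h (-z)).2.scomp z (hasDerivAt_neg z)).neg.congr_deriv ?_
    simp

theorem translate {T : ℝ} (hP : Function.Periodic P T) (h : IsSturmSolution P ω v u) :
    IsSturmSolution P ω (fun z => v (z + T)) (fun z => u (z + T)) := by
  intro z
  constructor
  · refine ((h (z + T)).1.comp_add_const z T).congr_deriv ?_
    rw [hP]
  · exact (h (z + T)).2.comp_add_const z T

theorem sub (h₁ : IsSturmSolution P ω v₁ u₁) (h₂ : IsSturmSolution P ω v₂ u₂) :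
    IsSturmSolution P ω (fun z => v₁ z - v₂ z) (fun z => u₁ z - u₂ z) := fun z =>
  ⟨((h₁ z).1.sub (h₂ z).1).congr_deriv (by ring), ((h₁ z).2.sub (h₂ z).2).congr_deriv (by ring)⟩

theorem linearCombination (a b : ℝ) (h₁ : IsSturmSolution P ω v₁ u₁)
    (h₂ : IsSturmSolution P ω v₂ u₂) :
    IsSturmSolution P ω (fun z => a * v₁ z + b * v₂ z) (fun z => a * u₁ z + b * u₂ z) := fun z =>
  ⟨(((h₁ z).1.const_mul a).add ((h₂ z).1.const_mul b)).congr_deriv (by ring),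
    (((h₁ z).2.const_mul a).add ((h₂ z).2.const_mul b)).congr_deriv (by ring)⟩

end IsSturmSolution

/-- A Prüfer angle is the phase of a solution of the Sturm system. -/
theorem exists_solution_of_pruefer {P : ℝ → ℝ} (hPc : Continuous P) {ω : ℝ} {θ : ℝ → ℝ}
    (hθ : ∀ z, HasDerivAt θ (prueferField P ω z (θ z)) z) :
    ∃ v u : ℝ → ℝ, IsSturmSolution P ω v u ∧ v 0 = sin (θ 0) ∧ u 0 = cos (θ 0) ∧
      ∀ z, ∃ r > 0, v z = r * sin (θ z) ∧ u z = r * cos (θ z) := by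
  have hθc : Continuous θ := continuous_iff_continuousAt.2 fun z => (hθ z).continuousAt
  let g : ℝ → ℝ := fun z => ω * (P z - 1) * (sin (θ z) * cos (θ z))
  have hg : Continuous g := by fun_prop
  let R : ℝ → ℝ := fun z => exp (∫ t in (0 : ℝ)..z, g t)
  have hR : ∀ z, HasDerivAt R (R z * g z) z := fun z =>
    (intervalIntegral.integral_hasDerivAt_right (hg.intervalIntegrable _ _)
      (hg.stronglyMeasurableAtFilter _ _) hg.continuousAt).exp
  refine ⟨fun z => R z * sin (θ z), fun z => R z * cos (θ z), fun z => ⟨?_, ?_⟩, ?_, ?_,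
    fun z => ⟨R z, exp_pos _, rfl, rfl⟩⟩
  · refine ((hR z).mul (hθ z).sin).congr_deriv ?_
    simp only [g, prueferField]
    linear_combination (ω * R z * P z * cos (θ z)) * sin_sq_add_cos_sq (θ z)
  · refine ((hR z).mul (hθ z).cos).congr_deriv ?_
    simp only [g, prueferField]
    linear_combination (-ω * R z * sin (θ z)) * sin_sq_add_cos_sq (θ z)
  · simp [R]
  · simp [R]

section FundamentalSystem

variable {P c uc s us v u : ℝ → ℝ} {ω L : ℝ}

theorem fundamental_parity (hPe : ∀ z, P (-z) = P z)
    (hc : IsSturmSolution P ω c uc) (hs : IsSturmSolution P ω s us)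
    (hc0 : c 0 = 1) (huc0 : uc 0 = 0) (hs0 : s 0 = 0) (hus0 : us 0 = 1) (z : ℝ) :
    c (-z) = c z ∧ uc (-z) = -uc z ∧ s (-z) = -s z ∧ us (-z) = us z := by
  have h1 := IsSturmSolution.eq_combination hc hs hc0 huc0 hs0 hus0 (hc.reflect hPe) z
  have h2 := IsSturmSolution.eq_combination hc hs hc0 huc0 hs0 hus0 (hs.reflect hPe) z
  simp only [neg_zero, hc0, huc0, hs0, hus0] at h1 h2
  refine ⟨?_, ?_, ?_, ?_⟩ <;> linarith [h1.1, h1.2, h2.1, h2.2]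

theorem IsSturmSolution.eq_zero_of_point (hc : IsSturmSolution P ω c uc)
    (hs : IsSturmSolution P ω s us)
    (hc0 : c 0 = 1) (huc0 : uc 0 = 0) (hs0 : s 0 = 0) (hus0 : us 0 = 1)
    (h : IsSturmSolution P ω v u) {w : ℝ} (hv : v w = 0) (hu : u w = 0) (z : ℝ) : v z = 0 := by
  have e1 := h.wronskian_eq hc w 0
  have e2 := h.wronskian_eq hs w 0
  simp only [hc0, huc0, hs0, hus0, hv, hu] at e1 e2
  have := (hc.eq_combination hs hc0 huc0 hs0 hus0 h z).1
  have hv0 : v 0 = 0 := by linarith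
  have hu0 : u 0 = 0 := by linarith
  simpa [hv0, hu0] using this

theorem periodic_sine_solution (hPe : ∀ z, P (-z) = P z) (hPp : Function.Periodic P (2 * L))
    (hc : IsSturmSolution P ω c uc) (hs : IsSturmSolution P ω s us)
    (hc0 : c 0 = 1) (huc0 : uc 0 = 0) (hs0 : s 0 = 0) (hus0 : us 0 = 1) (hL : s L = 0) :
    Function.Periodic s (2 * L) := by
  have hpar := fundamental_parity hPe hc hs hc0 huc0 hs0 hus0 L
  intro z
  have e : -L + 2 * L = L := by ring
  have := IsSturmSolution.eq_zero_of_point hc hs hc0 huc0 hs0 hus0 ((hs.translate hPp).sub hs)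
    (w := -L) (by rw [e, hpar.2.2.1, hL]; simp)
    (by rw [e, hpar.2.2.2]; simp) z
  linarith

theorem periodic_cosine_solution (hPe : ∀ z, P (-z) = P z) (hPp : Function.Periodic P (2 * L))
    (hc : IsSturmSolution P ω c uc) (hs : IsSturmSolution P ω s us)
    (hc0 : c 0 = 1) (huc0 : uc 0 = 0) (hs0 : s 0 = 0) (hus0 : us 0 = 1) (hL : uc L = 0) :
    Function.Periodic c (2 * L) := by
  have hpar := fundamental_parity hPe hc hs hc0 huc0 hs0 hus0 L
  intro z
  have e : -L + 2 * L = L := by ring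
  have := IsSturmSolution.eq_zero_of_point hc hs hc0 huc0 hs0 hus0 ((hc.translate hPp).sub hc)
    (w := -L) (by rw [e, hpar.1]; simp)
    (by rw [e, hpar.2.1, hL]; simp) z
  linarith

theorem IsSturmSolution.coeff_of_periodic (hc : IsSturmSolution P ω c uc)
    (hPe : ∀ z, P (-z) = P z) (hs : IsSturmSolution P ω s us)
    (hc0 : c 0 = 1) (huc0 : uc 0 = 0) (hs0 : s 0 = 0) (hus0 : us 0 = 1)
    (h : IsSturmSolution P ω v u) (hv : Function.Periodic v (2 * L))
    (hu : Function.Periodic u (2 * L)) : v 0 * uc L = 0 ∧ u 0 * s L = 0 := by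
  have hpar := fundamental_parity hPe hc hs hc0 huc0 hs0 hus0 L
  have e : -L + 2 * L = L := by ring
  have h1 := hv (-L)
  have h2 := hu (-L)
  rw [e] at h1 h2
  have a := hc.eq_combination hs hc0 huc0 hs0 hus0 h L
  have b := hc.eq_combination hs hc0 huc0 hs0 hus0 h (-L)
  rw [hpar.1, hpar.2.1, hpar.2.2.1, hpar.2.2.2] at b
  constructor <;> linarith [a.1, a.2, b.1, b.2]

theorem IsSturmSolution.periodic_snd (hω : 0 < ω) (hP0 : ∀ z, 0 < P z)
    (hPp : Function.Periodic P (2 * L)) (h : IsSturmSolution P ω v u)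
    (hv : Function.Periodic v (2 * L)) : Function.Periodic u (2 * L) := by
  intro z
  have h1 := (h.translate hPp z).1
  have e : (fun z => v (z + 2 * L)) = v := funext hv
  rw [e] at h1
  have h2 := h1.unique (h z).1
  exact mul_left_cancel₀ (hP0 z).ne' (mul_left_cancel₀ hω.ne' h2)

open Classical in
/-- Periodic solutions form a space whose dimension counts the periodic members of the even/odd
fundamental system. -/
theorem finrank_span_periodic (hω : 0 < ω) (hP0 : ∀ z, 0 < P z) (hPe : ∀ z, P (-z) = P z)
    (hPp : Function.Periodic P (2 * L))
    (hc : IsSturmSolution P ω c uc) (hs : IsSturmSolution P ω s us)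
    (hc0 : c 0 = 1) (huc0 : uc 0 = 0) (hs0 : s 0 = 0) (hus0 : us 0 = 1)
    {E : Set (ℝ → ℝ)}
    (hE : ∀ v, v ∈ E ↔ (∃ u, IsSturmSolution P ω v u) ∧ Function.Periodic v (2 * L)) :
    ((∃ v ∈ E, v ≠ 0) ↔ uc L = 0 ∨ s L = 0) ∧ Module.finrank ℝ (Submodule.span ℝ E) =
      (if uc L = 0 then 1 else 0) + (if s L = 0 then 1 else 0) := by
  have hcE : uc L = 0 → c ∈ E := fun h => (hE c).2
    ⟨⟨uc, hc⟩, periodic_cosine_solution hPe hPp hc hs hc0 huc0 hs0 hus0 h⟩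
  have hsE : s L = 0 → s ∈ E := fun h => (hE s).2
    ⟨⟨us, hs⟩, periodic_sine_solution hPe hPp hc hs hc0 huc0 hs0 hus0 h⟩
  have hcomb : ∀ v ∈ E, ∃ a b : ℝ, v = a • c + b • s ∧ a * uc L = 0 ∧ b * s L = 0 := by
    intro v hv
    obtain ⟨⟨u, h⟩, hvp⟩ := (hE v).1 hv
    refine ⟨v 0, u 0, ?_, hc.coeff_of_periodic hPe hs hc0 huc0 hs0 hus0 h hvp
      (h.periodic_snd hω hP0 hPp hvp)⟩
    ext z
    simpa using (hc.eq_combination hs hc0 huc0 hs0 hus0 h z).1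
  have hcne : c ≠ 0 := fun h => by simp [h] at hc0
  have hsne : s ≠ 0 := by
    rintro rfl
    have h1 := (hs 0).1.unique (hasDerivAt_const (0 : ℝ) (0 : ℝ))
    rw [hus0] at h1
    have := mul_pos hω (hP0 0)
    linarith
  refine ⟨⟨?_, fun h => h.elim (fun h => ⟨c, hcE h, hcne⟩) fun h => ⟨s, hsE h, hsne⟩⟩, ?_⟩
  · rintro ⟨v, hv, hv0⟩
    by_contra! hcon
    obtain ⟨a, b, rfl, ha, hb⟩ := hcomb v hv
    exact hv0 (by
      simp [(mul_eq_zero.1 ha).resolve_right hcon.1, (mul_eq_zero.1 hb).resolve_right hcon.2])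
  have hind : LinearIndependent ℝ ![c, s] := by
    rw [LinearIndependent.pair_iff]
    intro a b hab
    have ha : a = 0 := by simpa [hc0, hs0] using congrFun hab 0
    refine ⟨ha, ?_⟩
    rw [ha, zero_smul, zero_add] at hab
    exact (smul_eq_zero.1 hab).resolve_right hsne
  by_cases h1 : uc L = 0 <;> by_cases h2 : s L = 0
  · have hspan : Submodule.span ℝ E = Submodule.span ℝ (Set.range ![c, s]) := by
      apply le_antisymm <;> rw [Submodule.span_le]
      · intro v hv
        obtain ⟨a, b, rfl, -, -⟩ := hcomb v hv
        exact Submodule.add_mem _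
          (Submodule.smul_mem _ _ (Submodule.subset_span ⟨0, rfl⟩))
          (Submodule.smul_mem _ _ (Submodule.subset_span ⟨1, rfl⟩))
      · rintro _ ⟨i, rfl⟩
        fin_cases i
        · exact Submodule.subset_span (hcE h1)
        · exact Submodule.subset_span (hsE h2)
    rw [hspan, finrank_span_eq_card hind]
    simp [h1, h2]
  · have hspan : Submodule.span ℝ E = Submodule.span ℝ {c} := by
      apply le_antisymm <;> rw [Submodule.span_le]
      · intro v hv
        obtain ⟨a, b, rfl, -, hb⟩ := hcomb v hv
        rw [(mul_eq_zero.1 hb).resolve_right h2, zero_smul, add_zero]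
        exact Submodule.smul_mem _ _ (Submodule.mem_span_singleton_self _)
      · rintro _ rfl
        exact Submodule.subset_span (hcE h1)
    rw [hspan, finrank_span_singleton hcne]
    simp [h1, h2]
  · have hspan : Submodule.span ℝ E = Submodule.span ℝ {s} := by
      apply le_antisymm <;> rw [Submodule.span_le]
      · intro v hv
        obtain ⟨a, b, rfl, ha, -⟩ := hcomb v hv
        rw [(mul_eq_zero.1 ha).resolve_right h1, zero_smul, zero_add]
        exact Submodule.smul_mem _ _ (Submodule.mem_span_singleton_self _)
      · rintro _ rfl
        exact Submodule.subset_span (hsE h2)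
    rw [hspan, finrank_span_singleton hsne]
    simp [h1, h2]
  · have hspan : Submodule.span ℝ E = ⊥ := by
      rw [eq_bot_iff, Submodule.span_le]
      intro v hv
      obtain ⟨a, b, rfl, ha, hb⟩ := hcomb v hv
      simp [(mul_eq_zero.1 ha).resolve_right h1, (mul_eq_zero.1 hb).resolve_right h2]
    rw [hspan]
    simp [h1, h2]

end FundamentalSystem

/-- A continuous strictly increasing function that climbs from `b` to a value in
`(b + (N - 1)π, b + Nπ]` crosses exactly `N - 1` translates `b + jπ` in the open interval. -/
theorem ncard_crossings {g : ℝ → ℝ} {k b : ℝ} {N : ℕ} (hk : 0 < k)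
    (hg : Continuous g) (hmono : StrictMono g) (h0 : g 0 = b)
    (h1 : b + (N - 1) * π < g k) (h2 : g k ≤ b + N * π) :
    {ω : ℝ | 0 < ω ∧ ω < k ∧ ∃ j : ℤ, g ω = b + j * π}.Finite ∧
      {ω : ℝ | 0 < ω ∧ ω < k ∧ ∃ j : ℤ, g ω = b + j * π}.ncard = N - 1 := by
  have himg : g '' {ω : ℝ | 0 < ω ∧ ω < k ∧ ∃ j : ℤ, g ω = b + j * π}
      = (fun j : ℕ => b + j * π) '' (Finset.Ico 1 N : Finset ℕ) := by
    ext y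
    constructor
    · rintro ⟨ω, ⟨hω0, hωk, j, hj⟩, rfl⟩
      have a1 := hmono hω0
      have a2 := hmono hωk
      rw [h0, hj] at a1
      rw [hj] at a2
      have j1 : (0 : ℝ) < j := by
        by_contra hcon
        nlinarith [pi_pos]
      have j2 : (j : ℝ) < N := by
        by_contra hcon
        nlinarith [pi_pos]
      have j1' : 0 < j := by exact_mod_cast j1
      have j2' : j < N := by exact_mod_cast j2
      refine ⟨j.toNat, ?_, ?_⟩
      · simp only [Finset.coe_Ico, Set.mem_Ico]
        omega
      · have : (j.toNat : ℝ) = j := by exact_mod_cast Int.toNat_of_nonneg j1'.le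
        simp only [hj, this]
    · rintro ⟨j, hj, rfl⟩
      simp only [Finset.coe_Ico, Set.mem_Ico] at hj
      have j1 : (1 : ℝ) ≤ j := by exact_mod_cast hj.1
      have j2 : (j : ℝ) ≤ N - 1 := by
        have : ((j + 1 : ℕ) : ℝ) ≤ N := by exact_mod_cast hj.2
        push_cast at this
        linarith
      obtain ⟨ω, hω, hgω⟩ := intermediate_value_Ioo hk.le hg.continuousOn
        (show b + j * π ∈ Set.Ioo (g 0) (g k) by
          constructor <;> nlinarith [pi_pos])
      exact ⟨ω, ⟨hω.1, hω.2, j, by simpa using hgω⟩, hgω⟩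
  have hinj : Function.Injective (fun j : ℕ => b + j * π) := by
    intro i j hij
    have : (i : ℝ) * π = j * π := by simpa using hij
    exact_mod_cast mul_right_cancel₀ pi_ne_zero this
  constructor
  · refine Set.Finite.of_finite_image ?_ hmono.injective.injOn
    rw [himg]
    exact (Finset.finite_toSet _).image _
  · rw [← Set.ncard_image_of_injective _ hmono.injective, himg, Set.ncard_image_of_injective _ hinj,
      Set.ncard_coe_finset]
    simp

/-- An unbounded continuous function crosses infinitely many translates of `πℤ` beyond `k`. -/
theorem infinite_crossings {g : ℝ → ℝ} {k : ℝ} (hg : Continuous g)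
    (htop : Filter.Tendsto g Filter.atTop Filter.atTop) :
    {ω : ℝ | k < ω ∧ ∃ j : ℤ, g ω = j * π}.Infinite := by
  obtain ⟨n₀, hn₀⟩ := exists_nat_gt (g k / π)
  have hcross : ∀ n : ℕ, ∃ ω, k < ω ∧ g ω = ((n₀ + n : ℕ) : ℝ) * π := by
    intro n
    have hlt : g k < ((n₀ + n : ℕ) : ℝ) * π := by
      rw [div_lt_iff₀ pi_pos] at hn₀
      push_cast
      nlinarith [pi_pos, (Nat.cast_nonneg n : (0 : ℝ) ≤ n)]
    obtain ⟨b, hb, hkb⟩ := ((htop.eventually_gt_atTop (((n₀ + n : ℕ) : ℝ) * π)).and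
      (Filter.eventually_ge_atTop k)).exists
    obtain ⟨ω, hω, he⟩ := intermediate_value_Ioo hkb hg.continuousOn ⟨hlt, hb⟩
    exact ⟨ω, hω.1, he⟩
  choose ω hω he using hcross
  refine Set.infinite_of_injective_forall_mem (f := ω) (fun i j hij => ?_)
    fun n => ⟨hω n, (n₀ + n : ℕ), by simpa using he n⟩
  have := he i
  rw [hij, he j] at this
  have := mul_right_cancel₀ pi_ne_zero this
  norm_cast at this
  omega

/-- The even and odd fundamental solutions for all frequencies, together with their phases. -/
theorem exists_fundamental_family {P : ℝ → ℝ} {m M : ℝ} (hPc : Continuous P)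
    (hP : ∀ z, m ≤ P z ∧ P z ≤ M) (hm : 0 < m) (θ₀ : ℝ) :
    ∃ θ v u : ℝ → ℝ → ℝ, (∀ ω, θ ω 0 = θ₀) ∧
      (∀ ω z, HasDerivAt (θ ω) (prueferField P ω z (θ ω z)) z) ∧
      (∀ ω, IsSturmSolution P ω (v ω) (u ω)) ∧
      (∀ ω, v ω 0 = sin θ₀) ∧ (∀ ω, u ω 0 = cos θ₀) ∧
      (∀ ω z, v ω z = 0 ↔ sin (θ ω z) = 0) ∧ (∀ ω z, u ω z = 0 ↔ cos (θ ω z) = 0) := by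
  choose θ h0 hθ using fun ω => exists_pruefer hPc hP hm ω θ₀
  choose v u hvu hv hu hr using fun ω => exists_solution_of_pruefer hPc (hθ ω)
  refine ⟨θ, v, u, h0, hθ, hvu, fun ω => by rw [hv, h0], fun ω => by rw [hu, h0],
    fun ω z => ?_, fun ω z => ?_⟩
  · obtain ⟨r, hr0, h1, -⟩ := hr ω z
    rw [h1, mul_eq_zero, or_iff_right hr0.ne']
  · obtain ⟨r, hr0, -, h2⟩ := hr ω z
    rw [h2, mul_eq_zero, or_iff_right hr0.ne']

theorem sin_eq_zero_iff_crossing (x : ℝ) : sin x = 0 ↔ ∃ j : ℤ, x = 0 + j * π := by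
  rw [sin_eq_zero_iff]
  exact exists_congr fun j => by rw [zero_add, eq_comm]

theorem cos_eq_zero_iff_crossing (x : ℝ) : cos x = 0 ↔ ∃ j : ℤ, x = π / 2 + j * π := by
  rw [cos_eq_zero_iff]
  exact exists_congr fun j => by
    constructor <;> intro h <;> linarith

open Classical in
/-- If the phases of the odd and even solutions at frequency `k` have climbed by `Nπ` and by an
amount in `((N - 1/2)π, Nπ)` over a half period, then the periodic problem has `2N - 2` eigenvalues
with frequency in `(0, k)`, counted with multiplicity. -/
theorem sum_finrank_periodic {P : ℝ → ℝ} {m M L k : ℝ} {N : ℕ} (hPc : Continuous P)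
    (hP : ∀ z, m ≤ P z ∧ P z ≤ M) (hm : 0 < m) (hPe : ∀ z, P (-z) = P z)
    (hPp : Function.Periodic P (2 * L)) (hL : 0 < L) (hk : 0 < k)
    (hsin : ∀ θ : ℝ → ℝ, θ 0 = 0 → (∀ z, HasDerivAt θ (prueferField P k z (θ z)) z) →
      θ L = N * π)
    (hcos : ∀ θ : ℝ → ℝ, θ 0 = π / 2 → (∀ z, HasDerivAt θ (prueferField P k z (θ z)) z) →
      N * π < θ L ∧ θ L < N * π + π / 2)
    {E : ℝ → Set (ℝ → ℝ)}
    (hE : ∀ ω > 0, ∀ v, v ∈ E ω ↔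
      (∃ u, IsSturmSolution P ω v u) ∧ Function.Periodic v (2 * L)) :
    ∃ hfin : {ω : ℝ | 0 < ω ∧ ω < k ∧ ∃ v ∈ E ω, v ≠ 0}.Finite,
      ∑ ω ∈ hfin.toFinset, Module.finrank ℝ (Submodule.span ℝ (E ω)) = 2 * N - 2 := by
  have hP0 : ∀ z, 0 < P z := fun z => hm.trans_le (hP z).1
  obtain ⟨α, s, us, hα0, hα, hs, hs0, hus0, hsz, -⟩ := exists_fundamental_family hPc hP hm 0
  obtain ⟨β, c, uc, hβ0, hβ, hc, hc0, huc0, -, hucz⟩ :=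
    exists_fundamental_family hPc hP hm (π / 2)
  simp only [sin_zero, cos_zero, sin_pi_div_two, cos_pi_div_two] at hs0 hus0 hc0 huc0
  have hchar := fun ω (hω : 0 < ω) => finrank_span_periodic hω hP0 hPe hPp (hc ω) (hs ω)
    (hc0 ω) (huc0 ω) (hs0 ω) (hus0 ω) (hE ω hω)
  simp only [hsz, hucz, sin_eq_zero_iff_crossing, cos_eq_zero_iff_crossing] at hchar
  have hstat : ∀ ω, ω = 0 → ∀ {θ : ℝ → ℝ}, (∀ z, HasDerivAt θ (prueferField P ω z (θ z)) z) →
      θ L = θ 0 := by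
    rintro ω rfl θ hθ
    refine is_const_of_deriv_eq_zero (fun z => (hθ z).differentiableAt) (fun z => ?_) L 0
    rw [(hθ z).deriv, prueferField, zero_mul]
  have hA := ncard_crossings (N := N) (g := fun ω => α ω L) (b := 0) hk
    (continuous_pruefer_frequency hP hm hα0 hα hL.le)
    (fun ω₁ ω₂ h => pruefer_lt_of_lt hP hm h (by rw [hα0, hα0]) (hα ω₁) (hα ω₂) hL)
    (by rw [hstat 0 rfl (hα 0), hα0])
    (by rw [hsin _ (hα0 k) (hα k)]; linarith [pi_pos])
    (by rw [hsin _ (hα0 k) (hα k)]; linarith)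
  have hck := hcos _ (hβ0 k) (hβ k)
  have hB := ncard_crossings (N := N) (g := fun ω => β ω L) (b := π / 2) hk
    (continuous_pruefer_frequency hP hm hβ0 hβ hL.le)
    (fun ω₁ ω₂ h => pruefer_lt_of_lt hP hm h (by rw [hβ0, hβ0]) (hβ ω₁) (hβ ω₂) hL)
    (by rw [hstat 0 rfl (hβ 0), hβ0])
    (by linarith [pi_pos]) (by linarith)
  set A : Set ℝ := {ω | 0 < ω ∧ ω < k ∧ ∃ j : ℤ, α ω L = 0 + j * π} with hAdef
  set B : Set ℝ := {ω | 0 < ω ∧ ω < k ∧ ∃ j : ℤ, β ω L = π / 2 + j * π} with hBdef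
  have hW : {ω : ℝ | 0 < ω ∧ ω < k ∧ ∃ v ∈ E ω, v ≠ 0} = B ∪ A := by
    ext ω
    constructor
    · rintro ⟨h0, h1, h⟩
      exact ((hchar ω h0).1.1 h).imp (fun h => ⟨h0, h1, h⟩) fun h => ⟨h0, h1, h⟩
    · rintro (⟨h0, h1, h⟩ | ⟨h0, h1, h⟩)
      · exact ⟨h0, h1, (hchar ω h0).1.2 (Or.inl h)⟩
      · exact ⟨h0, h1, (hchar ω h0).1.2 (Or.inr h)⟩
  have hfin : {ω : ℝ | 0 < ω ∧ ω < k ∧ ∃ v ∈ E ω, v ≠ 0}.Finite := hW ▸ hB.1.union hA.1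
  refine ⟨hfin, ?_⟩
  have hterm : ∀ ω ∈ hfin.toFinset, Module.finrank ℝ (Submodule.span ℝ (E ω)) =
      (if ω ∈ B then 1 else 0) + (if ω ∈ A then 1 else 0) := by
    intro ω hω
    obtain ⟨h0, h1, -⟩ := hfin.mem_toFinset.1 hω
    rw [(hchar ω h0).2]
    simp [hAdef, hBdef, h0, h1]
  rw [Finset.sum_congr rfl hterm, Finset.sum_add_distrib, Finset.sum_boole, Finset.sum_boole]
  have hfB : hfin.toFinset.filter (· ∈ B) = hB.1.toFinset := by
    ext ω
    simp only [Finset.mem_filter, Set.Finite.mem_toFinset, hW]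
    exact ⟨fun h => h.2, fun h => ⟨Or.inl h, h⟩⟩
  have hfA : hfin.toFinset.filter (· ∈ A) = hA.1.toFinset := by
    ext ω
    simp only [Finset.mem_filter, Set.Finite.mem_toFinset, hW]
    exact ⟨fun h => h.2, fun h => ⟨Or.inr h, h⟩⟩
  rw [hfA, hfB, ← Set.ncard_eq_toFinset_card _ hA.1, ← Set.ncard_eq_toFinset_card _ hB.1,
    hA.2, hB.2]
  simp only [Nat.cast_id]
  omega

/-- There are infinitely many periodic eigenfrequencies above any threshold. -/
theorem infinite_periodic_frequencies {P : ℝ → ℝ} {m M L k : ℝ} (hPc : Continuous P)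
    (hP : ∀ z, m ≤ P z ∧ P z ≤ M) (hm : 0 < m) (hPe : ∀ z, P (-z) = P z)
    (hPp : Function.Periodic P (2 * L)) (hL : 0 < L) (hk : 0 < k)
    {E : ℝ → Set (ℝ → ℝ)}
    (hE : ∀ ω > 0, ∀ v, v ∈ E ω ↔
      (∃ u, IsSturmSolution P ω v u) ∧ Function.Periodic v (2 * L)) :
    {ω : ℝ | k < ω ∧ ∃ v ∈ E ω, v ≠ 0}.Infinite := by
  have hP0 : ∀ z, 0 < P z := fun z => hm.trans_le (hP z).1
  obtain ⟨α, s, us, hα0, hα, hs, hs0, hus0, hsz, -⟩ := exists_fundamental_family hPc hP hm 0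
  obtain ⟨-, c, uc, -, -, hc, hc0, huc0, -, -⟩ := exists_fundamental_family hPc hP hm (π / 2)
  simp only [sin_zero, cos_zero, sin_pi_div_two, cos_pi_div_two] at hs0 hus0 hc0 huc0
  have hm1 : 0 < min m 1 := lt_min hm one_pos
  have hgrow : ∀ ω, 0 ≤ ω → ω * (min m 1 * L) ≤ α ω L := by
    intro ω hω
    have hmono : Monotone fun z => α ω z - ω * min m 1 * z := by
      refine monotone_of_hasDerivAt_nonneg (f' := fun z => prueferField P ω z (α ω z) -
        ω * min m 1) (fun z => (hα ω z).sub (by simpa using (hasDerivAt_id z).const_mul _)) ?_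
      intro z
      have := mul_le_mul_of_nonneg_left (prueferField_factor_bounds (hP z) hm (α ω z)).1 hω
      simpa [prueferField] using this
    have := hmono hL.le
    simp only [hα0, mul_zero, sub_zero] at this
    linarith
  have htop : Filter.Tendsto (fun ω => α ω L) Filter.atTop Filter.atTop := by
    refine Filter.tendsto_atTop_mono' _ ?_
      (Filter.tendsto_id.atTop_mul_const (mul_pos hm1 hL))
    filter_upwards [Filter.eventually_ge_atTop 0] with ω hω using hgrow ω hω
  refine (infinite_crossings (k := k)
    (continuous_pruefer_frequency hP hm hα0 hα hL.le) htop).mono ?_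
  rintro ω ⟨hω, h⟩
  have h0 := hk.trans hω
  refine ⟨hω, (finrank_span_periodic h0 hP0 hPe hPp (hc ω) (hs ω)
    (hc0 ω) (huc0 ω) (hs0 ω) (hus0 ω) (hE ω h0)).1.2 (Or.inr ?_)⟩
  rw [hsz, sin_eq_zero_iff_crossing]
  simpa using h

/-- The phases of the odd and even solutions interlace. -/
theorem pruefer_interlace {P : ℝ → ℝ} (hPc : Continuous P) {ω : ℝ} {α β : ℝ → ℝ}
    (hα0 : α 0 = 0) (hβ0 : β 0 = π / 2)
    (hα : ∀ z, HasDerivAt α (prueferField P ω z (α z)) z)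
    (hβ : ∀ z, HasDerivAt β (prueferField P ω z (β z)) z) (z : ℝ) :
    α z < β z ∧ β z < α z + π := by
  obtain ⟨s, us, hs, hs0, hus0, hrs⟩ := exists_solution_of_pruefer hPc hα
  obtain ⟨c, uc, hc, hc0, huc0, hrc⟩ := exists_solution_of_pruefer hPc hβ
  have hne : ∀ x, sin (β x - α x) ≠ 0 := by
    intro x hx
    have hw := hc.wronskian_eq hs x 0
    rw [hs0, hus0, hc0, huc0, hα0, hβ0] at hw
    obtain ⟨r, -, h1, h2⟩ := hrs x
    obtain ⟨q, -, h3, h4⟩ := hrc x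
    rw [h1, h2, h3, h4] at hw
    rw [sin_sub] at hx
    simp only [sin_zero, cos_zero, sin_pi_div_two, cos_pi_div_two] at hw
    have : q * r * (sin (β x) * cos (α x) - cos (β x) * sin (α x)) = 1 := by linarith
    rw [hx] at this
    linarith
  have hcont : Continuous fun x => β x - α x :=
    continuous_iff_continuousAt.2 fun x => ((hβ x).sub (hα x)).continuousAt
  have hmem : ∀ y, y ∈ Set.uIcc (β 0 - α 0) (β z - α z) → sin y ≠ 0 := by
    intro y hy
    obtain ⟨x, -, rfl⟩ := intermediate_value_uIcc hcont.continuousOn hy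
    exact hne x
  rw [hα0, hβ0] at hmem
  constructor
  · by_contra! hcon
    refine hmem 0 ?_ sin_zero
    rw [Set.mem_uIcc]
    right
    constructor <;> linarith [pi_pos]
  · by_contra! hcon
    refine hmem π ?_ sin_pi
    rw [Set.mem_uIcc]
    left
    constructor <;> linarith [pi_pos]

/-- A nonconstant even `2π`-periodic travelling wave of small amplitude, with the equation and its
first integral in the form `φ³ U'' = -k² U`, `φ² (1 - U'²) = k²` for `φ = γ - U² / 2` and
`k = φ 0`. -/
structure IsSmallWave (U : ℝ → ℝ) (γ k : ℝ) : Prop where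
  contDiff : ContDiff ℝ (⊤ : ℕ∞) U
  even : ∀ z, U (-z) = U z
  periodic : Function.Periodic U (2 * π)
  nonconst : ∃ z w, U z ≠ U w
  one_lt : 1 < γ
  lt_bound : γ < 11 / 10
  abs_bound : ∀ z, |U z| ≤ 1 / 10
  eq_speed : k = γ - U 0 ^ 2 / 2
  energy : ∀ z, (γ - U z ^ 2 / 2) ^ 2 * (1 - deriv U z ^ 2) = k ^ 2
  second : ∀ z, (γ - U z ^ 2 / 2) ^ 3 * deriv (deriv U) z = -(k ^ 2 * U z)

namespace IsSmallWave

variable {U : ℝ → ℝ} {γ k : ℝ}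

theorem differentiable (h : IsSmallWave U γ k) : Differentiable ℝ U :=
  h.contDiff.differentiable (by simp)

theorem contDiff_deriv (h : IsSmallWave U γ k) : ContDiff ℝ (⊤ : ℕ∞) (deriv U) :=
  (contDiff_infty_iff_deriv.1 h.contDiff).2

theorem phi_bounds (h : IsSmallWave U γ k) (z : ℝ) :
    199 / 200 < γ - U z ^ 2 / 2 ∧ γ - U z ^ 2 / 2 ≤ γ := by
  have h1 := abs_le.1 (h.abs_bound z)
  have h2 := h.one_lt
  constructor <;> nlinarith [sq_nonneg (U z)]

theorem phi_pos (h : IsSmallWave U γ k) (z : ℝ) : 0 < γ - U z ^ 2 / 2 := by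
  linarith [(h.phi_bounds z).1]

theorem speed_bounds (h : IsSmallWave U γ k) : 199 / 200 < k ∧ k ≤ γ := h.eq_speed ▸ h.phi_bounds 0

theorem weight_bounds (h : IsSmallWave U γ k) (z : ℝ) :
    1 / 2 ≤ ((γ - U z ^ 2 / 2) ^ 3)⁻¹ ∧ ((γ - U z ^ 2 / 2) ^ 3)⁻¹ ≤ 11 / 10 := by
  obtain ⟨h1, h2⟩ := h.phi_bounds z
  have h3 := h.lt_bound
  set φ := γ - U z ^ 2 / 2
  have hφ : 0 < φ := by linarith
  have l : (199 / 200 : ℝ) ^ 3 ≤ φ ^ 3 := by gcongr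
  have r : φ ^ 3 ≤ (11 / 10 : ℝ) ^ 3 := by gcongr; linarith
  constructor
  · rw [le_inv_comm₀ (by norm_num) (by positivity)]
    norm_num at r ⊢; linarith
  · rw [inv_le_comm₀ (by positivity) (by norm_num)]
    norm_num at l ⊢; linarith

theorem contDiff_weight (h : IsSmallWave U γ k) :
    ContDiff ℝ (⊤ : ℕ∞) fun z => ((γ - U z ^ 2 / 2) ^ 3)⁻¹ := by
  have hU := h.contDiff
  exact ContDiff.inv (by fun_prop) fun z => (pow_pos (h.phi_pos z) 3).ne'

theorem deriv_neg (h : IsSmallWave U γ k) (z : ℝ) : deriv U (-z) = -deriv U z := by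
  have h1 := (h.differentiable (-z)).hasDerivAt.scomp z (hasDerivAt_neg z)
  have e : U ∘ Neg.neg = U := funext h.even
  have h2 := (h.differentiable z).hasDerivAt.unique (e ▸ h1)
  rw [h2]; simp

theorem deriv_periodic (h : IsSmallWave U γ k) : Function.Periodic (deriv U) (2 * π) := by
  intro z
  have h1 := (h.differentiable (z + 2 * π)).hasDerivAt.comp_add_const z (2 * π)
  have e : (fun x => U (x + 2 * π)) = U := funext h.periodic
  rw [e] at h1
  exact h1.unique (h.differentiable z).hasDerivAt

theorem deriv_zero (h : IsSmallWave U γ k) : deriv U 0 = 0 := by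
  have := h.deriv_neg 0
  rw [neg_zero] at this
  linarith

theorem deriv_nat_mul_pi (h : IsSmallWave U γ k) (n : ℕ) : deriv U (n * π) = 0 := by
  have h1 := h.deriv_neg (n * π)
  have h2 := h.deriv_periodic.nat_mul n (-(n * π))
  rw [show -(n * π) + n * (2 * π) = n * π by ring] at h2
  linarith

theorem deriv_ne_zero (h : IsSmallWave U γ k) : deriv U ≠ 0 := by
  intro hz
  obtain ⟨z, w, hzw⟩ := h.nonconst
  exact hzw (is_const_of_deriv_eq_zero h.differentiable (fun x => congrFun hz x) z w)

theorem zero_ne_zero (h : IsSmallWave U γ k) : U 0 ≠ 0 := by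
  intro h0
  apply h.deriv_ne_zero
  ext z
  have hk : k = γ := by rw [h.eq_speed, h0]; ring
  have he := h.energy z
  have hφ := h.phi_bounds z
  have hp := h.phi_pos z
  rw [hk] at he
  have : (γ - U z ^ 2 / 2) ^ 2 * deriv U z ^ 2 ≤ 0 := by nlinarith
  have h2 : 0 < (γ - U z ^ 2 / 2) ^ 2 := by positivity
  have h3 : deriv U z ^ 2 ≤ 0 := by
    by_contra! hcon
    have := mul_pos h2 hcon
    linarith
  exact pow_eq_zero_iff (two_ne_zero) |>.1 (le_antisymm h3 (sq_nonneg _))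

theorem sq_nat_mul_pi (h : IsSmallWave U γ k) (n : ℕ) : U (n * π) ^ 2 = U 0 ^ 2 := by
  have he := h.energy (n * π)
  rw [h.deriv_nat_mul_pi] at he
  have hk := h.speed_bounds
  have hp := h.phi_pos (n * π)
  have := (sq_eq_sq₀ hp.le (by linarith)).1 (by linarith : (γ - U (n * π) ^ 2 / 2) ^ 2 = k ^ 2)
  linarith [h.eq_speed]

theorem nat_mul_pi_ne_zero (h : IsSmallWave U γ k) (n : ℕ) : U (n * π) ≠ 0 := by
  intro h0
  have := h.sq_nat_mul_pi n
  rw [h0] at this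
  exact h.zero_ne_zero (by nlinarith)

theorem deriv_two_eq (h : IsSmallWave U γ k) (z : ℝ) :
    deriv (deriv U) z = -(k ^ 2 * (((γ - U z ^ 2 / 2) ^ 3)⁻¹ * U z)) := by
  have := (h.phi_pos z).ne'
  have hs := h.second z
  generalize γ - U z ^ 2 / 2 = φ at *
  field_simp
  linarith

/-- Translation invariance: `U'` solves the Sturm system at the frequency `k`. -/
theorem isSturmSolution_deriv (h : IsSmallWave U γ k) :
    IsSturmSolution (fun z => ((γ - U z ^ 2 / 2) ^ 3)⁻¹) k (deriv U) (fun z => -(k * U z)) := by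
  intro z
  constructor
  · refine (h.contDiff_deriv.differentiable (by simp) z).hasDerivAt.congr_deriv ?_
    rw [h.deriv_two_eq]; ring
  · exact ((h.differentiable z).hasDerivAt.const_mul k).neg

/-- The phase of the odd solution at the frequency `k` advances by `π` per half wavelength. -/
theorem sine_phase (h : IsSmallWave U γ k) {θ : ℝ → ℝ} (h0 : θ 0 = 0)
    (hθ : ∀ z, HasDerivAt θ
      (prueferField (fun z => ((γ - U z ^ 2 / 2) ^ 3)⁻¹) k z (θ z)) z) (n : ℕ) :
    θ (n * π) = n * π := by
  obtain ⟨s, us, hs, hs0, hus0, hr⟩ :=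
    exists_solution_of_pruefer h.contDiff_weight.continuous hθ
  have hk := h.speed_bounds
  have hγ := h.lt_bound
  have hsin : ∀ n : ℕ, sin (θ (n * π)) = 0 := by
    intro n
    have hw := h.isSturmSolution_deriv.wronskian_eq hs (n * π) 0
    rw [h.deriv_nat_mul_pi, h.deriv_zero, hs0, h0, sin_zero] at hw
    obtain ⟨r, hr0, h1, -⟩ := hr (n * π)
    rw [h1] at hw
    have : (k * U (n * π) * r) * sin (θ (n * π)) = 0 := by linarith
    refine (mul_eq_zero.1 this).resolve_left ?_
    have := h.nat_mul_pi_ne_zero n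
    have : k ≠ 0 := by linarith
    positivity
  have hspeed : ∀ z, 0 < prueferField (fun z => ((γ - U z ^ 2 / 2) ^ 3)⁻¹) k z (θ z) ∧
      prueferField (fun z => ((γ - U z ^ 2 / 2) ^ 3)⁻¹) k z (θ z) < 2 := by
    intro z
    obtain ⟨h1, h2⟩ := h.weight_bounds z
    have h3 := sin_sq_add_cos_sq (θ z)
    simp only [prueferField]
    set p := ((γ - U z ^ 2 / 2) ^ 3)⁻¹
    have a1 : 1 / 2 ≤ p * cos (θ z) ^ 2 + sin (θ z) ^ 2 := by
      nlinarith [sq_nonneg (sin (θ z)), sq_nonneg (cos (θ z))]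
    have a2 : p * cos (θ z) ^ 2 + sin (θ z) ^ 2 ≤ 11 / 10 := by
      nlinarith [sq_nonneg (sin (θ z)), sq_nonneg (cos (θ z))]
    constructor <;> nlinarith
  have hm1 : StrictMono θ := strictMono_of_hasDerivAt_pos hθ fun z => (hspeed z).1
  have hm2 : StrictMono fun z => z * 2 - θ z :=
    strictMono_of_hasDerivAt_pos
      (fun z => ((hasDerivAt_id z).mul_const 2).sub (hθ z))
      fun z => by linarith [(hspeed z).2]
  induction n with
  | zero => simp [h0]
  | succ n ih =>
    have hlt : (n : ℝ) * π < (n + 1 : ℕ) * π := by push_cast; nlinarith [pi_pos]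
    have a := hm1 hlt
    have b := hm2 hlt
    simp only [ih] at a b
    obtain ⟨j, hj⟩ := sin_eq_zero_iff.1 (hsin (n + 1))
    rw [← hj] at a b ⊢
    push_cast at a b
    have c1 : (n : ℝ) < j := by
      by_contra hcon
      nlinarith [pi_pos]
    have c2 : (j : ℝ) < n + 2 := by
      by_contra hcon
      nlinarith [pi_pos]
    have c1' : (n : ℤ) < j := by exact_mod_cast c1
    have c2' : j < (n : ℤ) + 2 := by exact_mod_cast c2
    have : j = n + 1 := by omega
    rw [this]; push_cast; ring

end IsSmallWave

theorem hasDerivAt_secular_profile {γ k : ℝ} (hγ : γ ≠ 0) {x : ℝ} (hφ : γ - x ^ 2 / 2 ≠ 0) :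
    HasDerivAt (fun x => (-(k ^ 2) + k ^ 2 * x ^ 2 * (2 * γ + (γ - x ^ 2 / 2)) / (4 * γ ^ 2)) *
        (((γ - x ^ 2 / 2) ^ 3)⁻¹ * x))
      (-(k ^ 2 * ((γ - x ^ 2 / 2) ^ 3)⁻¹) -
        k ^ 2 * x ^ 2 * (2 * γ + (γ - x ^ 2 / 2)) / (4 * γ ^ 2) * ((γ - x ^ 2 / 2) ^ 3)⁻¹) x := by
  have d0 := hasDerivAt_id' x
  have d1 : HasDerivAt (fun x : ℝ => γ - x ^ 2 / 2) (-x) x :=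
    (((d0.pow 2).div_const 2).const_sub γ).congr_deriv (by simp)
  have d2 := (((((d0.pow 2).const_mul (k ^ 2)).mul (d1.const_add (2 * γ))).div_const
    (4 * γ ^ 2)).const_add (-(k ^ 2))).mul (((d1.pow 3).inv (pow_ne_zero 3 hφ)).mul d0)
  refine d2.congr_deriv ?_
  simp only [Pi.mul_apply, Pi.inv_apply, Pi.pow_apply]
  obtain ⟨φ, e⟩ : ∃ φ, γ = φ + x ^ 2 / 2 := ⟨γ - x ^ 2 / 2, by ring⟩
  have e' : γ - x ^ 2 / 2 = φ := by rw [e]; ring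
  rw [e'] at hφ ⊢
  field_simp
  rw [e]
  ring

namespace IsSmallWave

variable {U : ℝ → ℝ} {γ k : ℝ}

/-- The solution at frequency `k` generated by the variation of the wave along its family. -/
theorem exists_secular_solution (h : IsSmallWave U γ k) {N : ℕ} (hN : 1 ≤ N) :
    ∃ v u : ℝ → ℝ, IsSturmSolution (fun z => ((γ - U z ^ 2 / 2) ^ 3)⁻¹) k v u ∧ u 0 = 0 ∧
      ∃ a > 0, ∃ b > 0, v (N * π) = -(a * U (N * π)) ∧ u (N * π) = -(b * U (N * π)) := by
  have hk := h.speed_bounds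
  have h1γ := h.one_lt
  have hγ0 : γ ≠ 0 := by linarith
  have hk0 : 0 < k := by linarith
  let g : ℝ → ℝ := fun z => k ^ 2 * U z ^ 2 * (2 * γ + (γ - U z ^ 2 / 2)) / (4 * γ ^ 2) *
    ((γ - U z ^ 2 / 2) ^ 3)⁻¹
  have hUc := h.contDiff.continuous
  have hPc := h.contDiff_weight.continuous
  have hg : Continuous g := Continuous.mul (by fun_prop) hPc
  have hg0 : ∀ z, 0 ≤ g z := fun z => by
    have := h.phi_pos z
    positivity
  let m : ℝ → ℝ := fun z => ∫ t in (0 : ℝ)..z, g t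
  have hm : ∀ z, HasDerivAt m (g z) z := fun z =>
    intervalIntegral.integral_hasDerivAt_right (hg.intervalIntegrable _ _)
      (hg.stronglyMeasurableAtFilter _ _) hg.continuousAt
  have hNπ : 0 < (N : ℝ) * π := by
    have : (1 : ℝ) ≤ N := by exact_mod_cast hN
    nlinarith [pi_pos]
  have hmpos : 0 < m (N * π) := by
    refine intervalIntegral.integral_pos hNπ hg.continuousOn (fun z _ => hg0 z)
      ⟨0, ⟨le_rfl, hNπ.le⟩, ?_⟩
    have := h.phi_pos 0
    have := h.zero_ne_zero
    positivity
  have hmul := mul_pos hk0 hmpos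
  have hdU := fun z => (h.differentiable z).hasDerivAt
  have hd2U := fun z => (h.isSturmSolution_deriv z).1
  refine ⟨fun z => (-(k ^ 2) + k ^ 2 * U z ^ 2 * (2 * γ + (γ - U z ^ 2 / 2)) / (4 * γ ^ 2)) *
      (((γ - U z ^ 2 / 2) ^ 3)⁻¹ * U z) + m z * deriv U z,
    fun z => -(k * (deriv U z + m z * U z)), fun z => ⟨?_, ?_⟩, ?_,
    (k ^ 2 - k ^ 2 * U (N * π) ^ 2 * (2 * γ + (γ - U (N * π) ^ 2 / 2)) / (4 * γ ^ 2)) *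
      ((γ - U (N * π) ^ 2 / 2) ^ 3)⁻¹, ?_, k * m (N * π), hmul, ?_, ?_⟩
  · refine (((hasDerivAt_secular_profile (k := k) hγ0 (h.phi_pos z).ne').comp z (hdU z)).add
      ((hm z).mul (hd2U z))).congr_deriv ?_
    simp only [g]
    ring
  · refine (((hd2U z).add ((hm z).mul (hdU z))).const_mul k).neg.congr_deriv ?_
    simp only [g]
    ring
  · simp [m, h.deriv_zero]
  · have hp := h.phi_pos (N * π)
    refine mul_pos ?_ (by positivity)
    have hb := abs_le.1 (h.abs_bound (N * π))
    have hle := (h.phi_bounds (N * π)).2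
    have hU2 : U (N * π) ^ 2 ≤ 1 / 100 := by nlinarith
    have hk2 : 0 < k ^ 2 := by nlinarith
    rw [sub_pos, div_lt_iff₀ (by positivity), mul_assoc]
    refine mul_lt_mul_of_pos_left ?_ hk2
    nlinarith
  · simp only [h.deriv_nat_mul_pi]
    ring
  · simp only [h.deriv_nat_mul_pi]
    ring

/-- The phase of the even solution at the frequency `k` advances by `Nπ` up to an error less
than `π / 2` over `N` half wavelengths. -/
theorem cosine_phase (h : IsSmallWave U γ k) {N : ℕ} (hN : 1 ≤ N) {θ : ℝ → ℝ} (h0 : θ 0 = π / 2)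
    (hθ : ∀ z, HasDerivAt θ
      (prueferField (fun z => ((γ - U z ^ 2 / 2) ^ 3)⁻¹) k z (θ z)) z) :
    N * π < θ (N * π) ∧ θ (N * π) < N * π + π / 2 := by
  have hPc := h.contDiff_weight.continuous
  obtain ⟨α, hα0, hα⟩ := exists_pruefer hPc h.weight_bounds (by norm_num) k 0
  have hi := pruefer_interlace hPc hα0 h0 hα hθ (N * π)
  rw [h.sine_phase hα0 hα] at hi
  refine ⟨hi.1, ?_⟩
  obtain ⟨c, uc, hc, hc0, huc0, hr⟩ := exists_solution_of_pruefer hPc hθ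
  obtain ⟨v, u, hvu, hu0, a, ha, b, hb, hv1, hu1⟩ := h.exists_secular_solution hN
  have hw := hvu.wronskian_eq hc (N * π) 0
  obtain ⟨r, hr0, h1, h2⟩ := hr (N * π)
  rw [huc0, h0, cos_pi_div_two, hu0, hv1, hu1, h1, h2] at hw
  obtain ⟨t, ht⟩ : ∃ t, θ (N * π) = t + N * π := ⟨θ (N * π) - N * π, by ring⟩
  rw [ht] at hi hw ⊢
  rw [sin_add_nat_mul_pi, cos_add_nat_mul_pi] at hw
  have hU := h.nat_mul_pi_ne_zero N
  have hfac : (U (N * π) * r * (-1) ^ N) * (a * cos t - b * sin t) = 0 := by linarith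
  have hz := (mul_eq_zero.1 hfac).resolve_left (by positivity)
  by_contra! hcon
  have hs : 0 < sin t := sin_pos_of_pos_of_lt_pi (by linarith) (by linarith)
  have hcn : cos t ≤ 0 := cos_nonpos_of_pi_div_two_le_of_le (by linarith) (by linarith [pi_pos])
  nlinarith [mul_pos hb hs]

end IsSmallWave

theorem rpow_sq_neg_half {y : ℝ} (hy : 0 < y) (n : ℕ) : (y ^ 2) ^ (-(n : ℝ) / 2) = (y ^ n)⁻¹ := by
  rw [← rpow_natCast y 2, ← rpow_mul hy.le, ← rpow_natCast y n, ← rpow_neg hy.le]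
  congr 1
  push_cast
  ring

namespace IsSmallWave

variable {U : ℝ → ℝ} {γ k I : ℝ} {N : ℕ}

theorem mem_eigSetM_iff (h : IsSmallWave U γ k) (hI : γ ^ 2 - 2 * I = k ^ 2) {lam κ : ℝ}
    (hκ : κ = k ^ 2 - 2 * k ^ 3 * lam) (v : ℝ → ℝ) :
    v ∈ EigSetM U γ I lam N ↔ ContDiff ℝ (⊤ : ℕ∞) v ∧ Function.Periodic v (2 * π * N) ∧
      (∫ z in (0:ℝ)..(2 * π * N), v z) = 0 ∧
      ∀ z, HasDerivAt (fun w => (γ - U w ^ 2 / 2) ^ 3 * deriv v w) (-(κ * v z)) z := by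
  have hk : 0 < k := by linarith [h.speed_bounds.1]
  refine and_congr_right fun hv => and_congr_right fun _ => and_congr_right fun _ =>
    forall_congr' fun z => ?_
  have hdv : Differentiable ℝ (deriv v) :=
    (contDiff_infty_iff_deriv.1 hv).2.differentiable (by simp)
  have hU := h.differentiable
  have hdiff : DifferentiableAt ℝ (fun w => (γ - U w ^ 2 / 2) ^ 3 * deriv v w) z := by fun_prop
  have e1 : (γ ^ 2 - 2 * I) ^ (-(1 : ℝ) / 2) = k⁻¹ := by
    rw [hI]
    simpa using rpow_sq_neg_half hk 1
  have e2 : (fun w => (1 - (deriv U w) ^ 2) ^ (-(3:ℝ)/2) * deriv v w) =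
      fun w => (k ^ 3)⁻¹ * ((γ - U w ^ 2 / 2) ^ 3 * deriv v w) := by
    ext w
    have hφ := h.phi_pos w
    have hw : 1 - deriv U w ^ 2 = (k / (γ - U w ^ 2 / 2)) ^ 2 := by
      rw [div_pow, eq_div_iff (by positivity), ← h.energy w, mul_comm]
    have := rpow_sq_neg_half (div_pos hk hφ) 3
    rw [hw]
    push_cast at this
    rw [this, div_pow, inv_div]
    ring
  rw [e1, e2, deriv_const_mul_field]
  have hiff : HasDerivAt (fun w => (γ - U w ^ 2 / 2) ^ 3 * deriv v w) (-(κ * v z)) z ↔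
      deriv (fun w => (γ - U w ^ 2 / 2) ^ 3 * deriv v w) z = -(κ * v z) :=
    ⟨fun h => h.deriv, fun h => h ▸ hdiff.hasDerivAt⟩
  rw [hiff, hκ]
  generalize deriv (fun w => (γ - U w ^ 2 / 2) ^ 3 * deriv v w) z = D
  field_simp
  constructor <;> intro h <;> linarith

theorem weight_periodic (h : IsSmallWave U γ k) (N : ℕ) :
    Function.Periodic (fun z => ((γ - U z ^ 2 / 2) ^ 3)⁻¹) (2 * (N * π)) := by
  intro z
  have := h.periodic.nat_mul N z
  rw [show (N : ℝ) * (2 * π) = 2 * (N * π) by ring] at this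
  simp only [this]

theorem weight_pos (h : IsSmallWave U γ k) (z : ℝ) : 0 < ((γ - U z ^ 2 / 2) ^ 3)⁻¹ := by
  have := h.phi_pos z
  positivity

/-- Eigenfunctions with `k² - 2k³λ = ω² > 0` are the periodic solutions of the Sturm system. -/
theorem mem_eigSetM_iff_sturm (h : IsSmallWave U γ k) (hI : γ ^ 2 - 2 * I = k ^ 2) {lam ω : ℝ}
    (hω : 0 < ω) (hlam : ω ^ 2 = k ^ 2 - 2 * k ^ 3 * lam) (v : ℝ → ℝ) :
    v ∈ EigSetM U γ I lam N ↔
      (∃ u, IsSturmSolution (fun z => ((γ - U z ^ 2 / 2) ^ 3)⁻¹) ω v u) ∧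
        Function.Periodic v (2 * (N * π)) := by
  have hT : 2 * π * N = 2 * (N * π) := by ring
  rw [h.mem_eigSetM_iff hI hlam, hT]
  constructor
  · rintro ⟨hv, hper, -, hd⟩
    refine ⟨⟨fun z => (γ - U z ^ 2 / 2) ^ 3 * deriv v z / ω, fun z => ⟨?_, ?_⟩⟩, hper⟩
    · refine (hv.differentiable (by simp) z).hasDerivAt.congr_deriv ?_
      have := (h.phi_pos z).ne'
      beta_reduce
      generalize γ - U z ^ 2 / 2 = φ at *
      field_simp
    · refine ((hd z).div_const ω).congr_deriv ?_
      field_simp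
  · rintro ⟨⟨u, hu⟩, hper⟩
    have hsm := hu.contDiff h.contDiff_weight
    refine ⟨hsm.1, hper, ?_, fun z => ?_⟩
    · have hup := hu.periodic_snd hω h.weight_pos (h.weight_periodic N) hper
      rw [intervalIntegral.integral_eq_sub_of_hasDerivAt (f := fun z => -(u z / ω))
        (fun z _ => (((hu z).2.div_const ω).neg.congr_deriv (by field_simp)))
        (hsm.1.continuous.intervalIntegrable _ _), hup.eq, sub_self]
    · have e : (fun w => (γ - U w ^ 2 / 2) ^ 3 * deriv v w) = fun w => ω * u w := by
        ext w
        have := (h.phi_pos w).ne'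
        rw [(hu w).1.deriv]
        beta_reduce
        generalize γ - U w ^ 2 / 2 = φ at *
        field_simp
      rw [e]
      exact ((hu z).2.const_mul ω).congr_deriv (by ring)

/-- There are no eigenvalues with `k² - 2k³λ ≤ 0`. -/
theorem eq_zero_of_mem_eigSetM (h : IsSmallWave U γ k) (hI : γ ^ 2 - 2 * I = k ^ 2) (hN : 1 ≤ N)
    {lam : ℝ} (hlam : k ^ 2 - 2 * k ^ 3 * lam ≤ 0) {v : ℝ → ℝ} (hv : v ∈ EigSetM U γ I lam N) :
    v = 0 := by
  obtain ⟨hsm, hper, hmean, hd⟩ := (h.mem_eigSetM_iff hI rfl v).1 hv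
  set κ := k ^ 2 - 2 * k ^ 3 * lam
  have hT : 0 < 2 * π * N := by
    have : (1 : ℝ) ≤ N := by exact_mod_cast hN
    positivity
  have hdv := fun z => (hsm.differentiable (by simp) z).hasDerivAt
  have hdper : Function.Periodic (deriv v) (2 * π * N) := by
    intro z
    have h1 := (hdv (z + 2 * π * N)).comp_add_const z (2 * π * N)
    have e : (fun x => v (x + 2 * π * N)) = v := funext hper
    rw [e] at h1
    exact h1.unique (hdv z)
  have hUper : Function.Periodic U (2 * π * N) := by
    have := h.periodic.nat_mul N
    rwa [mul_comm] at this
  have hg : ∀ z, HasDerivAt (fun w => (γ - U w ^ 2 / 2) ^ 3 * deriv v w * v w)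
      ((γ - U z ^ 2 / 2) ^ 3 * deriv v z ^ 2 - κ * v z ^ 2) z := fun z =>
    ((hd z).mul (hdv z)).congr_deriv (by ring)
  have hnonneg : ∀ z, 0 ≤ (γ - U z ^ 2 / 2) ^ 3 * deriv v z ^ 2 := fun z => by
    have := h.phi_pos z
    positivity
  have hmono := monotone_of_hasDerivAt_nonneg hg fun z => by
    have := mul_nonneg (neg_nonneg.2 hlam) (sq_nonneg (v z))
    simp only [Pi.zero_apply]
    linarith [hnonneg z]
  have hgper : Function.Periodic (fun w => (γ - U w ^ 2 / 2) ^ 3 * deriv v w * v w)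
      (2 * π * N) := fun z => by simp only [hUper z, hdper z, hper z]
  have hconst : ∀ z w, z ≤ w → (γ - U z ^ 2 / 2) ^ 3 * deriv v z * v z =
      (γ - U w ^ 2 / 2) ^ 3 * deriv v w * v w := by
    intro z w hzw
    refine le_antisymm (hmono hzw) ?_
    obtain ⟨n, hn⟩ := exists_nat_gt ((w - z) / (2 * π * N))
    rw [div_lt_iff₀ hT] at hn
    have h1 := hgper.nat_mul n z
    have h2 := hmono (show w ≤ z + n * (2 * π * N) by linarith)
    exact h2.trans h1.le
  have hdz : ∀ z, deriv v z = 0 := by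
    intro z
    have hc : (fun w => (γ - U w ^ 2 / 2) ^ 3 * deriv v w * v w) =
        fun _ => (γ - U z ^ 2 / 2) ^ 3 * deriv v z * v z := by
      ext w
      rcases le_total z w with hzw | hzw
      · exact (hconst z w hzw).symm
      · exact hconst w z hzw
    have h1 := hg z
    rw [hc] at h1
    have h2 := h1.unique (hasDerivAt_const _ _)
    have h3 := mul_nonneg (neg_nonneg.2 hlam) (sq_nonneg (v z))
    have h4 : (γ - U z ^ 2 / 2) ^ 3 * deriv v z ^ 2 = 0 := by linarith [hnonneg z]
    have h5 := pow_pos (h.phi_pos z) 3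
    exact pow_eq_zero_iff two_ne_zero |>.1 ((mul_eq_zero.1 h4).resolve_left h5.ne')
  have hvc : ∀ z, v z = v 0 := fun z =>
    is_const_of_deriv_eq_zero (hsm.differentiable (by simp)) hdz z 0
  rw [intervalIntegral.integral_congr (g := fun _ => v 0) fun z _ => hvc z,
    intervalIntegral.integral_const, smul_eq_mul, sub_zero] at hmean
  ext z
  rw [hvc]
  exact (mul_eq_zero.1 hmean).resolve_left hT.ne'

theorem eigSetM_zero (h : IsSmallWave U γ k) (hI : γ ^ 2 - 2 * I = k ^ 2) (hN : 1 ≤ N) :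
    EigSetM U γ I 0 N = {v | ∃ c : ℝ, v = fun z => c * deriv U z} := by
  have hk : 0 < k := by linarith [h.speed_bounds.1]
  have hPe : ∀ z, ((γ - U (-z) ^ 2 / 2) ^ 3)⁻¹ = ((γ - U z ^ 2 / 2) ^ 3)⁻¹ := fun z => by
    rw [h.even]
  obtain ⟨-, s, us, -, -, hs, hs0, hus0, -, -⟩ := exists_fundamental_family
    h.contDiff_weight.continuous h.weight_bounds (by norm_num) 0
  obtain ⟨β, c, uc, hβ0, hβ, hc, hc0, huc0, -, hucz⟩ := exists_fundamental_family
    h.contDiff_weight.continuous h.weight_bounds (by norm_num) (π / 2)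
  simp only [sin_zero, cos_zero, sin_pi_div_two, cos_pi_div_two] at hs0 hus0 hc0 huc0
  have hU' := h.isSturmSolution_deriv
  ext v
  rw [h.mem_eigSetM_iff_sturm hI hk (by ring), Set.mem_ofPred_eq]
  constructor
  · rintro ⟨⟨u, hu⟩, hper⟩
    have hcoef := (hc k).coeff_of_periodic hPe (hs k) (hc0 k) (huc0 k) (hs0 k) (hus0 k) hu hper
      (hu.periodic_snd hk h.weight_pos (h.weight_periodic N) hper)
    have hucL : uc k (N * π) ≠ 0 := by
      rw [Ne, hucz]
      have hph := h.cosine_phase hN (hβ0 k) (hβ k)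
      intro hcos
      have hcos' : cos (β k (N * π) - N * π) = 0 := by
        rw [cos_sub_nat_mul_pi, hcos, mul_zero]
      exact (cos_pos_of_mem_Ioo ⟨by linarith [pi_pos], by linarith⟩).ne' hcos'
    have hv0 := (mul_eq_zero.1 hcoef.1).resolve_right hucL
    have hU0 := h.zero_ne_zero
    refine ⟨-(u 0 / (k * U 0)), funext fun z => ?_⟩
    have := (hc k).eq_zero_of_point (hs k) (hc0 k) (huc0 k) (hs0 k) (hus0 k)
      (hu.linearCombination 1 (u 0 / (k * U 0)) hU') (w := 0)
      (by simp [hv0, h.deriv_zero]) (by field_simp; ring) z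
    linarith
  · rintro ⟨c, rfl⟩
    refine ⟨⟨_, by simpa using hU'.linearCombination c 0 hU'⟩, fun z => ?_⟩
    have := h.deriv_periodic.nat_mul N z
    rw [show (N : ℝ) * (2 * π) = 2 * (N * π) by ring] at this
    simp only [this]

theorem sum_finrank_eigSetM (h : IsSmallWave U γ k) (hI : γ ^ 2 - 2 * I = k ^ 2) (hN : 1 ≤ N) :
    ∃ hfin : Set.Finite {lam : ℝ | 0 < lam ∧ ∃ v ∈ EigSetM U γ I lam N, v ≠ 0},
      (∑ lam ∈ hfin.toFinset,
        Module.finrank ℝ (Submodule.span ℝ (EigSetM U γ I lam N))) = 2 * N - 2 := by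
  have hk : 0 < k := by linarith [h.speed_bounds.1]
  have hNπ : 0 < (N : ℝ) * π := by
    have : (1 : ℝ) ≤ N := by exact_mod_cast hN
    positivity
  let f : ℝ → ℝ := fun ω => (k ^ 2 - ω ^ 2) / (2 * k ^ 3)
  have hf : ∀ ω, ω ^ 2 = k ^ 2 - 2 * k ^ 3 * f ω := fun ω => by
    simp only [f]
    field_simp
    ring
  obtain ⟨hfin, hsum⟩ := sum_finrank_periodic (N := N) (k := k) (L := N * π)
    h.contDiff_weight.continuous h.weight_bounds (by norm_num) (fun z => by rw [h.even])
    (h.weight_periodic N) hNπ hk (fun θ h0 hθ => h.sine_phase h0 hθ N)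
    (fun θ h0 hθ => h.cosine_phase hN h0 hθ) (E := fun ω => EigSetM U γ I (f ω) N)
    fun ω hω => h.mem_eigSetM_iff_sturm hI hω (hf ω)
  have himage : {lam : ℝ | 0 < lam ∧ ∃ v ∈ EigSetM U γ I lam N, v ≠ 0} =
      f '' {ω : ℝ | 0 < ω ∧ ω < k ∧ ∃ v ∈ EigSetM U γ I (f ω) N, v ≠ 0} := by
    ext lam
    constructor
    · rintro ⟨h0, v, hv, hv0⟩
      have hpos : 0 < k ^ 2 - 2 * k ^ 3 * lam := by
        by_contra! hcon
        exact hv0 (h.eq_zero_of_mem_eigSetM hI hN hcon hv)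
      have hfl : f √(k ^ 2 - 2 * k ^ 3 * lam) = lam := by
        simp only [f]
        rw [sq_sqrt hpos.le]
        field_simp
        ring
      refine ⟨√(k ^ 2 - 2 * k ^ 3 * lam), ⟨sqrt_pos.2 hpos, ?_, v, by rwa [hfl], hv0⟩, hfl⟩
      rw [sqrt_lt' hk]
      have : 0 < k ^ 3 * lam := by positivity
      linarith
    · rintro ⟨ω, ⟨h0, h1, hv⟩, rfl⟩
      refine ⟨?_, hv⟩
      have : 0 < k ^ 2 - ω ^ 2 := by nlinarith
      simp only [f]
      positivity
  have hfin' := himage ▸ hfin.image f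
  refine ⟨hfin', ?_⟩
  have hset : hfin'.toFinset = hfin.toFinset.image f := by
    ext lam
    rw [hfin'.mem_toFinset, himage]
    simp
  rw [hset, Finset.sum_image, hsum]
  intro ω₁ h₁ ω₂ h₂ he
  have p1 := (hfin.mem_toFinset.1 h₁).1
  have p2 := (hfin.mem_toFinset.1 h₂).1
  have e1 := hf ω₁
  have e2 := hf ω₂
  rw [he] at e1
  exact (sq_eq_sq₀ p1.le p2.le).1 (e1.trans e2.symm)

theorem infinite_neg_eigSetM (h : IsSmallWave U γ k) (hI : γ ^ 2 - 2 * I = k ^ 2) (hN : 1 ≤ N) :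
    {lam : ℝ | lam < 0 ∧ ∃ v ∈ EigSetM U γ I lam N, v ≠ 0}.Infinite := by
  have hk : 0 < k := by linarith [h.speed_bounds.1]
  have hNπ : 0 < (N : ℝ) * π := by
    have : (1 : ℝ) ≤ N := by exact_mod_cast hN
    positivity
  let f : ℝ → ℝ := fun ω => (k ^ 2 - ω ^ 2) / (2 * k ^ 3)
  have hf : ∀ ω, ω ^ 2 = k ^ 2 - 2 * k ^ 3 * f ω := fun ω => by
    simp only [f]
    field_simp
    ring
  have hinf := infinite_periodic_frequencies (k := k) (L := N * π)
    h.contDiff_weight.continuous h.weight_bounds (by norm_num) (fun z => by rw [h.even])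
    (h.weight_periodic N) hNπ hk (E := fun ω => EigSetM U γ I (f ω) N)
    fun ω hω => h.mem_eigSetM_iff_sturm hI hω (hf ω)
  refine (hinf.image (f := f) ?_).mono ?_
  · intro ω₁ h₁ ω₂ h₂ he
    have e1 := hf ω₁
    have e2 := hf ω₂
    rw [he] at e1
    exact (sq_eq_sq₀ (hk.trans h₁.1).le (hk.trans h₂.1).le).1 (e1.trans e2.symm)
  · rintro _ ⟨ω, ⟨h1, hv⟩, rfl⟩
    refine ⟨?_, hv⟩
    have : k ^ 2 - ω ^ 2 < 0 := by nlinarith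
    simp only [f]
    exact div_neg_of_neg_of_pos this (by positivity)

end IsSmallWave

theorem first_integral_of_invariant {γ x y I : ℝ}
    (h : (1/2) * (γ - (1/2) * x ^ 2) ^ 2 * y ^ 2 + (γ / 2) * x ^ 2 - (1/8) * x ^ 4 = I) :
    (γ - x ^ 2 / 2) ^ 2 * (1 - y ^ 2) = γ ^ 2 - 2 * I := by
  rw [← h]
  ring

theorem isSmallWave_of_equation {U : ℝ → ℝ} {γ I : ℝ} (hγ : γ ∈ Set.Ioo (1 : ℝ) (1 + 1 / 10))
    (heven : ∀ z, U (-z) = U z) (hU : ContDiff ℝ (⊤ : ℕ∞) U) (hnc : ∃ z w, U z ≠ U w)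
    (hper : Function.Periodic U (2 * π))
    (hode : ∀ z, deriv (fun w => (γ - (1/2) * (U w) ^ 2) * deriv U w) z + U z = 0)
    (hb : ∀ z, |U z| ≤ 1 / 10)
    (hI : ∀ z, (1/2) * (γ - (1/2) * (U z) ^ 2) ^ 2 * (deriv U z) ^ 2
      + (γ / 2) * (U z) ^ 2 - (1/8) * (U z) ^ 4 = I) :
    IsSmallWave U γ (γ - U 0 ^ 2 / 2) ∧ γ ^ 2 - 2 * I = (γ - U 0 ^ 2 / 2) ^ 2 := by
  have hdU := fun z => (hU.differentiable (by simp) z).hasDerivAt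
  have hd2U := fun z =>
    ((contDiff_infty_iff_deriv.1 hU).2.differentiable (by simp) z).hasDerivAt
  have hd0 : deriv U 0 = 0 := by
    have h1 := (hdU (-0)).scomp 0 (hasDerivAt_neg (0 : ℝ))
    have e : U ∘ Neg.neg = U := funext heven
    rw [e] at h1
    have h2 := (hdU 0).unique h1
    rw [neg_zero, smul_eq_mul] at h2
    linarith
  have hen := fun z => first_integral_of_invariant (hI z)
  have hk : γ ^ 2 - 2 * I = (γ - U 0 ^ 2 / 2) ^ 2 := by
    rw [← hen 0, hd0]
    ring
  refine ⟨⟨hU, heven, hper, hnc, hγ.1, by linarith [hγ.2], hb, rfl, fun z => (hen z).trans hk,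
    fun z => ?_⟩, hk⟩
  have hd := ((((hdU z).pow 2).const_mul (1 / 2)).const_sub γ).mul (hd2U z)
  have h1 := hode z
  have h2 := hd.deriv
  simp only [Pi.mul_def, Pi.pow_def] at h2
  rw [h2] at h1
  rw [← hk, ← hen z]
  norm_num at h1
  linear_combination (γ - U z ^ 2 / 2) ^ 2 * h1

theorem spectrum_M_modified_reduced_ostrovsky :
    ∃ ε > (0:ℝ), ∀ N : ℕ, 1 ≤ N → ∀ γ ∈ Set.Ioo (1:ℝ) (1 + ε), ∀ U : ℝ → ℝ,
      (∀ z : ℝ, U (-z) = U z) → ContDiff ℝ (⊤ : ℕ∞) U → (∃ z w : ℝ, U z ≠ U w) →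
      Function.Periodic U (2 * π) →
      (∀ z : ℝ,
        deriv (fun w => (γ - (1/2) * (U w) ^ 2) * deriv U w) z + U z = 0) →
      (∀ z : ℝ, |U z| ≤ ε) →
      (∀ z : ℝ, |deriv U z| < 1) →
      ∀ I : ℝ,
      (∀ z : ℝ,
        (1/2) * (γ - (1/2) * (U z) ^ 2) ^ 2 * (deriv U z) ^ 2
          + (γ / 2) * (U z) ^ 2 - (1/8) * (U z) ^ 4 = I) →
      (∃ hfin : Set.Finite {lam : ℝ | 0 < lam ∧ ∃ v ∈ EigSetM U γ I lam N, v ≠ 0},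
        (∑ lam ∈ hfin.toFinset,
          Module.finrank ℝ (Submodule.span ℝ (EigSetM U γ I lam N))) = 2 * N - 2) ∧
      (EigSetM U γ I 0 N = {v | ∃ c : ℝ, v = fun z => c * deriv U z} ∧ deriv U ≠ 0) ∧
      {lam : ℝ | lam < 0 ∧ ∃ v ∈ EigSetM U γ I lam N, v ≠ 0}.Infinite := by
  refine ⟨1 / 10, by norm_num, fun N hN γ hγ U heven hU hnc hper hode hb _ I hI => ?_⟩
  obtain ⟨h, hk⟩ := isSmallWave_of_equation hγ heven hU hnc hper hode hb hI
  exact ⟨h.sum_finrank_eigSetM hk hN, ⟨h.eigSetM_zero hk hN, h.deriv_ne_zero⟩,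
    h.infinite_neg_eigSetM hk hN⟩
end
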